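/- Let X be a product system over ℕ² of nondegenerate regular A-correspondences with generating system (Y,θ), let ℰY_2 = Y_2 ⊗_A O_{Y_1} with universal covariant representation (π_{ℰY_2}, t_{ℰY_2}), and define σ_0(a) = π_{ℰY_2}(π_{Y_1}(a)), σ_1(y) = π_{ℰY_2}(t_{Y_1}(y)) for y ∈ Y_1, and σ_2(x) = t_{ℰY_2}(x ⊗ 1) for x ∈ Y_2. Then (σ_0,σ_1) and (σ_0,σ_2) are Cuntz–Pimsner covariant representations of Y_1 and Y_2 in O(ℰY_2), and they satisfy σ_2σ_1 = σ_1σ_2 ∘ θ_{21}; consequently there is an essentially unique Cuntz–Pimsner covariant representation ψ of X in O(ℰY_2) with ψ_{e_i} = σ_i and ψ_0 = σ_0. -/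

import Mathlib

/- ############################################################
   Common framework: C*-correspondences, interior tensor products
   (characterized relationally), representations, Cuntz–Pimsner algebras,
   product systems over ℕ^k, generating systems, and the ℰ / ℛθ
   constructions of the paper (characterized relationally).
   ############################################################ -/

noncomputable section

open Filter Topology

universe u

/-- A C*-correspondence over a (not necessarily unital) C*-algebra `A`:
a right Hilbert `A`-module `X` together with a left action of `A` by
adjointable (bounded) operators.  The rank-one operators `θ_{x,y}` are
bundled as data together with their defining property. -/
structure Corr (A : Type u) [NonUnitalCStarAlgebra A] : Type (u + 1) where
  X : Type u
  [nacg : NormedAddCommGroup X]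
  [nsp : NormedSpace ℂ X]
  [cmpl : CompleteSpace X]
  /-- right action of `A` -/
  ract : X → A → X
  /-- `A`-valued inner product -/
  inner : X → X → A
  /-- left action `φ : A → L(X)` by adjointable operators -/
  lactL : A → X →L[ℂ] X
  /-- the rank-one ("compact") operators `θ_{x,y} z = x ⬝ ⟨y, z⟩` -/
  rankOne : X → X → X →L[ℂ] X
  ract_add_left : ∀ x y a, ract (x + y) a = ract x a + ract y a
  ract_add_right : ∀ x a b, ract x (a + b) = ract x a + ract x b
  ract_mul : ∀ x a b, ract x (a * b) = ract (ract x a) b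
  ract_smul : ∀ (c : ℂ) x a, ract (c • x) a = c • ract x a
  ract_smul' : ∀ (c : ℂ) x a, ract x (c • a) = c • ract x a
  inner_add_right : ∀ x y z, inner x (y + z) = inner x y + inner x z
  inner_smul_right : ∀ (c : ℂ) x y, inner x (c • y) = c • inner x y
  inner_star : ∀ x y, star (inner x y) = inner y x
  inner_ract_right : ∀ x y a, inner x (ract y a) = inner x y * a
  norm_eq : ∀ x, ‖x‖ ^ 2 = ‖inner x x‖
  lact_add : ∀ a b, lactL (a + b) = lactL a + lactL b
  lact_mul : ∀ a b, lactL (a * b) = (lactL a).comp (lactL b)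
  lact_smul : ∀ (c : ℂ) a, lactL (c • a) = c • lactL a
  lact_adjoint : ∀ a x y, inner (lactL a x) y = inner x (lactL (star a) y)
  rankOne_apply : ∀ x y z, rankOne x y z = ract x (inner y z)

attribute [instance] Corr.nacg Corr.nsp Corr.cmpl

variable {A : Type u} [NonUnitalCStarAlgebra A]

/-- Nondegeneracy: `A·X` is (topologically) all of `X`. -/
def Corr.Nondeg (W : Corr A) : Prop :=
  closure (Submodule.span ℂ {y : W.X | ∃ a x, y = W.lactL a x} : Set W.X) = Set.univ

/-- Regularity: the left action is injective and takes values in the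
compact operators (the closed span of the rank-one operators). -/
def Corr.Regular (W : Corr A) : Prop :=
  (∀ a, W.lactL a = 0 → a = 0) ∧
    ∀ a, W.lactL a ∈
      closure (Submodule.span ℂ {T : W.X →L[ℂ] W.X | ∃ x y, T = W.rankOne x y} :
        Set (W.X →L[ℂ] W.X))

/-- standing hypotheses of the paper: nondegenerate and regular -/
def Corr.Reg (W : Corr A) : Prop := W.Nondeg ∧ W.Regular

/-- a bare function which is a continuous `ℂ`-linear map -/
structure IsCLMap {E F : Type u} [NormedAddCommGroup E] [NormedSpace ℂ E]
    [NormedAddCommGroup F] [NormedSpace ℂ F] (f : E → F) : Prop where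
  map_add : ∀ x y, f (x + y) = f x + f y
  map_smul : ∀ (c : ℂ) x, f (c • x) = c • f x
  cont : Continuous f

/-- a map of correspondences over the same algebra which is an isomorphism -/
structure IsCorrIsoFun (W Z : Corr A) (f : W.X → Z.X) : Prop where
  bijective : Function.Bijective f
  map_add : ∀ x y, f (x + y) = f x + f y
  map_smul : ∀ (c : ℂ) x, f (c • x) = c • f x
  map_inner : ∀ x y, Z.inner (f x) (f y) = W.inner x y
  map_ract : ∀ x a, f (W.ract x a) = Z.ract (f x) a
  map_lact : ∀ a x, f (W.lactL a x) = Z.lactL a (f x)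

/-- an isomorphism of correspondences over the same algebra (bundled) -/
structure CorrIso (W Z : Corr A) : Type u where
  toFun : W.X → Z.X
  invFun : Z.X → W.X
  left_inv : ∀ x, invFun (toFun x) = x
  right_inv : ∀ y, toFun (invFun y) = y
  map_add : ∀ x y, toFun (x + y) = toFun x + toFun y
  map_smul : ∀ (c : ℂ) x, toFun (c • x) = c • toFun x
  map_inner : ∀ x y, Z.inner (toFun x) (toFun y) = W.inner x y
  map_ract : ∀ x a, toFun (W.ract x a) = Z.ract (toFun x) a
  map_lact : ∀ a x, toFun (W.lactL a x) = Z.lactL a (toFun x)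

/-- an isomorphism of correspondences lying over an isomorphism `Φ` of the
coefficient algebras -/
structure CorrIsoOver {B : Type u} [NonUnitalCStarAlgebra B]
    (Φ : A → B) (W : Corr A) (Z : Corr B) : Type u where
  toFun : W.X → Z.X
  bijective : Function.Bijective toFun
  map_add : ∀ x y, toFun (x + y) = toFun x + toFun y
  map_smul : ∀ (c : ℂ) x, toFun (c • x) = c • toFun x
  map_inner : ∀ x y, Z.inner (toFun x) (toFun y) = Φ (W.inner x y)
  map_ract : ∀ x a, toFun (W.ract x a) = Z.ract (toFun x) (Φ a)
  map_lact : ∀ a x, toFun (W.lactL a x) = Z.lactL (Φ a) (toFun x)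

/-- `T`, together with the bilinear map `m`, is a realization of the
balanced (interior) tensor product `W ⊗_A V` of correspondences over `A`. -/
structure IsTensor (W V T : Corr A) (m : W.X → V.X → T.X) : Prop where
  add_left : ∀ x x' y, m (x + x') y = m x y + m x' y
  add_right : ∀ x y y', m x (y + y') = m x y + m x y'
  smul_left : ∀ (c : ℂ) x y, m (c • x) y = c • m x y
  smul_right : ∀ (c : ℂ) x y, m x (c • y) = c • m x y
  balanced : ∀ x a y, m (W.ract x a) y = m x (V.lactL a y)
  inner : ∀ x y x' y',
    T.inner (m x y) (m x' y') = V.inner y (V.lactL (W.inner x x') y')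
  ract : ∀ x y a, T.ract (m x y) a = m x (V.ract y a)
  lact : ∀ a x y, T.lactL a (m x y) = m (W.lactL a x) y
  dense : closure (Submodule.span ℂ {z : T.X | ∃ x y, z = m x y} : Set T.X) = Set.univ

variable {B : Type u} [NonUnitalCStarAlgebra B]

/-- `π : A → B` is a *-homomorphism (stated elementwise) -/
structure IsStarHom (π : A → B) : Prop where
  map_add : ∀ a b, π (a + b) = π a + π b
  map_mul : ∀ a b, π (a * b) = π a * π b
  map_star : ∀ a, π (star a) = star (π a)
  map_smul : ∀ (c : ℂ) a, π (c • a) = c • π a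

/-- `(π, t)` is a representation (Toeplitz representation) of the
correspondence `W` in the C*-algebra `B`. -/
structure IsRep (W : Corr A) (π : A → B) (t : W.X → B) : Prop where
  hom : IsStarHom π
  t_add : ∀ x y, t (x + y) = t x + t y
  t_smul : ∀ (c : ℂ) x, t (c • x) = c • t x
  lact : ∀ a x, t (W.lactL a x) = π a * t x
  ract : ∀ x a, t (W.ract x a) = t x * π a
  inner : ∀ x y, star (t x) * t y = π (W.inner x y)

/-- Cuntz–Pimsner covariance of a representation of a *regular*
correspondence: whenever `φ(a)` is approximated in norm by finite sums of
rank-one operators `θ_{x,y}`, `π(a)` is approximated by the corresponding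
sums `t(x) t(y)*`.  (For regular correspondences this is equivalent to
`π = t⁽¹⁾ ∘ φ`.) -/
def CPCov (W : Corr A) (π : A → B) (t : W.X → B) : Prop :=
  ∀ (a : A) (N : ℕ → ℕ) (x y : ∀ n, Fin (N n) → W.X),
    Tendsto (fun n => ∑ r, W.rankOne (x n r) (y n r)) atTop (𝓝 (W.lactL a)) →
    Tendsto (fun n => ∑ r, t (x n r) * star (t (y n r))) atTop (𝓝 (π a))

/-- The Cuntz–Pimsner algebra of a correspondence `W`: a C*-algebra `O`
together with a universal covariant representation `(π, t)`:  `(π,t)` is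
covariant, `π` is injective, `O` is generated by the images of `π` and `t`,
and every covariant representation factors uniquely through `O`. -/
structure CPAlg (W : Corr A) : Type (u + 1) where
  O : Type u
  [alg : NonUnitalCStarAlgebra O]
  π : A → O
  t : W.X → O
  isRep : IsRep W π t
  covariant : CPCov W π t
  inj : Function.Injective π
  gen : ∀ S : Set O, IsClosed S →
    (∀ a, π a ∈ S) → (∀ x, t x ∈ S) →
    (∀ p q, p ∈ S → q ∈ S → p + q ∈ S) →
    (∀ p q, p ∈ S → q ∈ S → p * q ∈ S) →
    (∀ (c : ℂ) p, p ∈ S → c • p ∈ S) →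
    (∀ p, p ∈ S → star p ∈ S) → ∀ z, z ∈ S
  universal : ∀ (C : Type u) [NonUnitalCStarAlgebra C],
    ∀ (π' : A → C) (t' : W.X → C), IsRep W π' t' → CPCov W π' t' →
      ∃! h : O →⋆ₙₐ[ℂ] C, (∀ a, h (π a) = π' a) ∧ ∀ x, h (t x) = t' x

attribute [instance] CPAlg.alg

/- ##################  product systems over ℕ^k  ################## -/

/-- the `i`-th standard generator of `ℕ^k` -/
def egen {k : ℕ} (i : Fin k) : Fin k → ℕ := Pi.single i 1

/-- A product system over `ℕ^k` of (nondegenerate regular) correspondences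
over `A`:  fibers `fib s`, an associative multiplication implementing
isomorphisms `fib s ⊗_A fib t ≅ fib (s+t)`, and `fib 0 = A` (witnessed by
the unit map). -/
structure PSys (A : Type u) [NonUnitalCStarAlgebra A] (k : ℕ) : Type (u + 1) where
  fib : (Fin k → ℕ) → Corr A
  reg : ∀ s, (fib s).Reg
  mul : ∀ s t, (fib s).X → (fib t).X → (fib (s + t)).X
  isTensor : ∀ s t, IsTensor (fib s) (fib t) (fib (s + t)) (mul s t)
  assoc : ∀ s t u x y z,
    HEq (mul (s + t) u (mul s t x y) z) (mul s (t + u) x (mul t u y z))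
  unit : A → (fib 0).X
  unit_bij : Function.Bijective unit
  unit_add : ∀ a b, unit (a + b) = unit a + unit b
  unit_smul : ∀ (c : ℂ) a, unit (c • a) = c • unit a
  unit_inner : ∀ a b, (fib 0).inner (unit a) (unit b) = star a * b
  unit_lact : ∀ a b, (fib 0).lactL a (unit b) = unit (a * b)
  unit_ract : ∀ a b, (fib 0).ract (unit a) b = unit (a * b)
  unit_mul_left : ∀ s a x, HEq (mul 0 s (unit a) x) ((fib s).lactL a x)
  unit_mul_right : ∀ s x a, HEq (mul s 0 x (unit a)) ((fib s).ract x a)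

/-- a representation of a product system in a C*-algebra `B` -/
structure PSRep {k : ℕ} (Xs : PSys A k) (B : Type u) [NonUnitalCStarAlgebra B] :
    Type u where
  π : A → B
  ψ : ∀ s, (Xs.fib s).X → B
  isRep : ∀ s, IsRep (Xs.fib s) π (ψ s)
  ψ_zero : ∀ a, ψ 0 (Xs.unit a) = π a
  mul : ∀ s t x y, ψ s x * ψ t y = ψ (s + t) (Xs.mul s t x y)

/-- Cuntz–Pimsner covariance of a representation of a product system -/
def PSCPCov {k : ℕ} {Xs : PSys A k} {B : Type u} [NonUnitalCStarAlgebra B]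
    (r : PSRep Xs B) : Prop :=
  ∀ s, CPCov (Xs.fib s) r.π (r.ψ s)

/-- The Cuntz–Pimsner algebra `𝒪(X)` of a product system. -/
structure PSCPAlg {k : ℕ} (Xs : PSys A k) : Type (u + 1) where
  O : Type u
  [alg : NonUnitalCStarAlgebra O]
  rep : PSRep Xs O
  covariant : PSCPCov rep
  inj : Function.Injective rep.π
  gen : ∀ S : Set O, IsClosed S →
    (∀ a, rep.π a ∈ S) → (∀ s x, rep.ψ s x ∈ S) →
    (∀ p q, p ∈ S → q ∈ S → p + q ∈ S) →
    (∀ p q, p ∈ S → q ∈ S → p * q ∈ S) →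
    (∀ (c : ℂ) p, p ∈ S → c • p ∈ S) →
    (∀ p, p ∈ S → star p ∈ S) → ∀ z, z ∈ S
  universal : ∀ (C : Type u) [NonUnitalCStarAlgebra C],
    ∀ r : PSRep Xs C, PSCPCov r →
      ∃! h : O →⋆ₙₐ[ℂ] C,
        (∀ a, h (rep.π a) = r.π a) ∧ ∀ s x, h (rep.ψ s x) = r.ψ s x

attribute [instance] PSCPAlg.alg

/- ##################  generating systems  ################## -/

/-- a realization of a triple tensor product `W1 ⊗ W2 ⊗ W3` carrying both
a left pairing `(W1 ⊗ W2) ⊗ W3` and a right pairing `W1 ⊗ (W2 ⊗ W3)` -/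
structure Trip (W1 W2 W3 : Corr A) (T12 : Corr A) (m12 : W1.X → W2.X → T12.X)
    (T23 : Corr A) (m23 : W2.X → W3.X → T23.X) (P : Corr A) : Type u where
  lp : T12.X → W3.X → P.X
  rp : W1.X → T23.X → P.X
  lt : IsTensor T12 W3 P lp
  rt : IsTensor W1 T23 P rp
  compat : ∀ x y z, lp (m12 x y) z = rp x (m23 y z)

/-- the hexagonal relation for a triple of flip isomorphisms
`θij, θil, θjl`, stated relative to arbitrary realizations of the six
triple tensor products. -/
def HexProp (Yi Yj Yl : Corr A)
    (Tij Tji Til Tli Tjl Tlj : Corr A)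
    (mij : Yi.X → Yj.X → Tij.X) (mji : Yj.X → Yi.X → Tji.X)
    (mil : Yi.X → Yl.X → Til.X) (mli : Yl.X → Yi.X → Tli.X)
    (mjl : Yj.X → Yl.X → Tjl.X) (mlj : Yl.X → Yj.X → Tlj.X)
    (θij : Tij.X → Tji.X) (θil : Til.X → Tli.X) (θjl : Tjl.X → Tlj.X) : Prop :=
  ∀ (P1 P2 P3 P4 P5 P6 : Corr A)
    (R1 : Trip Yi Yj Yl Tij mij Tjl mjl P1)
    (R2 : Trip Yj Yi Yl Tji mji Til mil P2)
    (R3 : Trip Yj Yl Yi Tjl mjl Tli mli P3)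
    (R4 : Trip Yl Yj Yi Tlj mlj Tji mji P4)
    (R5 : Trip Yi Yl Yj Til mil Tlj mlj P5)
    (R6 : Trip Yl Yi Yj Tli mli Tij mij P6)
    (F1 : P1.X → P2.X) (F2 : P2.X → P3.X) (F3 : P3.X → P4.X)
    (F4 : P1.X → P5.X) (F5 : P5.X → P6.X) (F6 : P6.X → P4.X),
    IsCLMap F1 → IsCLMap F2 → IsCLMap F3 →
    IsCLMap F4 → IsCLMap F5 → IsCLMap F6 →
    (∀ u z, F1 (R1.lp u z) = R2.lp (θij u) z) →
    (∀ y v, F2 (R2.rp y v) = R3.rp y (θil v)) →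
    (∀ u z, F3 (R3.lp u z) = R4.lp (θjl u) z) →
    (∀ x v, F4 (R1.rp x v) = R5.rp x (θjl v)) →
    (∀ u z, F5 (R5.lp u z) = R6.lp (θil u) z) →
    (∀ x v, F6 (R6.rp x v) = R4.rp x (θij v)) →
    ∀ w, F3 (F2 (F1 w)) = F6 (F5 (F4 w))

/-- A generating system `(Y, θ)` of `k` correspondences over `A`:
correspondences `Y i`, chosen realizations `T i j` of the tensor products
`Y i ⊗_A Y j`, and flip isomorphisms `θ i j : Y i ⊗ Y j → Y j ⊗ Y i` with
`θ i i = id`, `θ j i = (θ i j)⁻¹`, satisfying the hexagonal relations. -/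
structure GenSys (A : Type u) [NonUnitalCStarAlgebra A] (k : ℕ) : Type (u + 1) where
  Y : Fin k → Corr A
  reg : ∀ i, (Y i).Reg
  T : Fin k → Fin k → Corr A
  tmul : ∀ i j, (Y i).X → (Y j).X → (T i j).X
  isTensor : ∀ i j, IsTensor (Y i) (Y j) (T i j) (tmul i j)
  θ : ∀ i j, CorrIso (T i j) (T j i)
  θ_diag : ∀ i x y, (θ i i).toFun (tmul i i x y) = tmul i i x y
  θ_symm : ∀ i j z, (θ j i).toFun ((θ i j).toFun z) = z
  hex : ∀ i j l, HexProp (Y i) (Y j) (Y l) (T i j) (T j i) (T i l) (T l i)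
    (T j l) (T l j) (tmul i j) (tmul j i) (tmul i l) (tmul l i) (tmul j l)
    (tmul l j) ((θ i j).toFun) ((θ i l).toFun) ((θ j l).toFun)

/-- the generating system obtained by keeping only `Y 1, …, Y m` -/
def GenSys.restrict {k : ℕ} (G : GenSys A k) (m : ℕ) (h : m ≤ k) : GenSys A m where
  Y i := G.Y (Fin.castLE h i)
  reg i := G.reg _
  T i j := G.T (Fin.castLE h i) (Fin.castLE h j)
  tmul i j := G.tmul _ _
  isTensor i j := G.isTensor _ _
  θ i j := G.θ _ _
  θ_diag i := G.θ_diag _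
  θ_symm i j := G.θ_symm _ _
  hex i j l := G.hex _ _ _

/-- `X` is *the* product system (over `ℕ^k`) generated by the generating
system `G` (Fowler–Sims); witnessed by compatible isomorphisms on the
generating fibers. -/
structure Generates {k : ℕ} (G : GenSys A k) (Xs : PSys A k) : Type u where
  ι : ∀ i, CorrIso (G.Y i) (Xs.fib (egen i))
  κ : ∀ i j, CorrIso (G.T i j) (Xs.fib (egen i + egen j))
  κ_mul : ∀ i j x y,
    (κ i j).toFun (G.tmul i j x y) =
      Xs.mul (egen i) (egen j) ((ι i).toFun x) ((ι j).toFun y)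
  θ_compat : ∀ i j z,
    HEq ((κ j i).toFun ((G.θ i j).toFun z)) ((κ i j).toFun z)

/- ############  mixed tensor products `W ⊗_A O` and `W ⊗_A V`  ############ -/

/-- `Z` (a correspondence over the C*-algebra `O`), with map `m`, is a
realization of the right Hilbert `O`-module `W ⊗_A O`, where `O` is an
`A`-algebra via `πA`.  (No condition on the left action of `O` on `Z`.) -/
structure MixedMod (W : Corr A) (O : Type u) [NonUnitalCStarAlgebra O]
    (πA : A → O) (Z : Corr O) (m : W.X → O → Z.X) : Prop where
  add_left : ∀ x x' S, m (x + x') S = m x S + m x' S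
  add_right : ∀ x S S', m x (S + S') = m x S + m x S'
  smul_left : ∀ (c : ℂ) x S, m (c • x) S = c • m x S
  smul_right : ∀ (c : ℂ) x S, m x (c • S) = c • m x S
  balanced : ∀ x a S, m (W.ract x a) S = m x (πA a * S)
  ract : ∀ x S T, Z.ract (m x S) T = m x (S * T)
  inner : ∀ x S y T, Z.inner (m x S) (m y T) = star S * (πA (W.inner x y) * T)
  dense : closure (Submodule.span ℂ {z : Z.X | ∃ x S, z = m x S} : Set Z.X) = Set.univ

/-- `P`, with pairing `p`, is a realization of the balanced tensor product
`W ⊗_A V` where `W` is a correspondence over `A` and `V` a correspondence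
over the `A`-algebra `O` (via `πA`); the left `A`-action is `πA`-compatible. -/
structure MixedPair (W : Corr A) {O : Type u} [NonUnitalCStarAlgebra O]
    (πA : A → O) (V P : Corr O) (p : W.X → V.X → P.X) : Prop where
  add_left : ∀ x x' v, p (x + x') v = p x v + p x' v
  add_right : ∀ x v v', p x (v + v') = p x v + p x v'
  smul_left : ∀ (c : ℂ) x v, p (c • x) v = c • p x v
  smul_right : ∀ (c : ℂ) x v, p x (c • v) = c • p x v
  balanced : ∀ x a v, p (W.ract x a) v = p x (V.lactL (πA a) v)
  inner : ∀ x v x' v',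
    P.inner (p x v) (p x' v') = V.inner v (V.lactL (πA (W.inner x x')) v')
  ract : ∀ x v S, P.ract (p x v) S = p x (V.ract v S)
  lact_pi : ∀ a x v, P.lactL (πA a) (p x v) = p (W.lactL a x) v
  dense : closure (Submodule.span ℂ {z : P.X | ∃ x v, z = p x v} : Set P.X) = Set.univ

/- ############  the correspondence `ℰYᵢ = Yᵢ ⊗_A 𝒪(Y₁)`  ############ -/

/-- `Z = Yi ⊗_A 𝒪(Y1)` with the left `𝒪(Y1)`-action determined by the flip
`θ : Y1 ⊗ Yi → Yi ⊗ Y1` (`T` and `T'` are realizations of these tensor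
products):  `π(a)` acts by `φ(a) ⊗ 1`, and `t(x)·(y ⊗ S) = (1 ⊗ V)(θ ⊗ 1)
(x ⊗ y ⊗ S)`. -/
structure ECorrData (Y1 Yi : Corr A)
    (T : Corr A) (mT : Y1.X → Yi.X → T.X)
    (T' : Corr A) (mT' : Yi.X → Y1.X → T'.X)
    (θ : T.X → T'.X)
    (C : CPAlg Y1) (Z : Corr C.O) (m : Yi.X → C.O → Z.X) : Prop where
  mod : MixedMod Yi C.O C.π Z m
  lact_pi : ∀ a y S, Z.lactL (C.π a) (m y S) = m (Yi.lactL a y) S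
  lact_t : ∃ μ : T'.X → C.O → Z.X,
    (∀ S, IsCLMap fun u => μ u S) ∧
    (∀ y u S, μ (mT' y u) S = m y (C.t u * S)) ∧
    ∀ x y S, Z.lactL (C.t x) (m y S) = μ (θ (mT x y)) S

/-- `Z = Yi ⊗_A 𝒪(Y p)` for a generating system `G`, with left action
determined by `θ p i` -/
def ECorr {k : ℕ} (G : GenSys A k) (p i : Fin k) (C : CPAlg (G.Y p))
    (Z : Corr C.O) (m : (G.Y i).X → C.O → Z.X) : Prop :=
  ECorrData (G.Y p) (G.Y i) (G.T p i) (G.tmul p i) (G.T i p) (G.tmul i p)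
    ((G.θ p i).toFun) C Z m

/-- `Z = Y j ⊗_A 𝒪(Y 1 ∗ ⋯ ∗ Y m)` with the left action of the
Cuntz–Pimsner algebra of the product system determined on the generators
`σ i = ψ_{e i}` via the flips `θ i j` and the absorption maps. -/
structure EPCorr {k : ℕ} (G : GenSys A k) {m : ℕ} (hm : m ≤ k)
    (Xs : PSys A m) (gen : Generates (G.restrict m hm) Xs) (C : PSCPAlg Xs)
    (j : Fin k) (Z : Corr C.O) (mm : (G.Y j).X → C.O → Z.X) : Prop where
  mod : MixedMod (G.Y j) C.O C.rep.π Z mm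
  lact_pi : ∀ a y S, Z.lactL (C.rep.π a) (mm y S) = mm ((G.Y j).lactL a y) S
  lact_t : ∀ i : Fin m,
    ∃ μ : (G.T j (Fin.castLE hm i)).X → C.O → Z.X,
      (∀ S, IsCLMap fun u => μ u S) ∧
      (∀ y u S, μ (G.tmul j (Fin.castLE hm i) y u) S =
        mm y (C.rep.ψ (egen i) ((gen.ι i).toFun u) * S)) ∧
      ∀ x y S, Z.lactL (C.rep.ψ (egen i) ((gen.ι i).toFun x)) (mm y S) =
        μ ((G.θ (Fin.castLE hm i) j).toFun (G.tmul (Fin.castLE hm i) j x y)) S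

/- ############  the isomorphism `ℛθ = ν⁻¹ (θ ⊗ 1) ν`  ############ -/

/-- Witness data expressing that `R : Zi ⊗_O Zj → Zj ⊗_O Zi` is the map
`ℛθ_{ij} = ν_{ji}⁻¹ (θ_{ij} ⊗ 1_O) ν_{ij}` of the paper, where
`Zi = Yi ⊗_A O`, `O = 𝒪(Y1)`, and `ν_{ij} : (Yi ⊗ O) ⊗_O (Yj ⊗ O) ≅
Yi ⊗ Yj ⊗ O` is the canonical absorption isomorphism. -/
structure RTheta (O : Type u) [NonUnitalCStarAlgebra O] (πA : A → O)
    (Yi Yj : Corr A) (Tij Tji : Corr A)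
    (mij : Yi.X → Yj.X → Tij.X) (mji : Yj.X → Yi.X → Tji.X)
    (θij : Tij.X → Tji.X)
    (Zi Zj : Corr O) (mmi : Yi.X → O → Zi.X) (mmj : Yj.X → O → Zj.X)
    (TZ TZr : Corr O) (mZ : Zi.X → Zj.X → TZ.X) (mZr : Zj.X → Zi.X → TZr.X)
    (R : TZ.X → TZr.X) : Type (u + 1) where
  Pl : Corr O
  Pr : Corr O
  pij : Yi.X → Zj.X → Pl.X
  pji : Yj.X → Zi.X → Pr.X
  hp : MixedPair Yi πA Zj Pl pij
  hpr : MixedPair Yj πA Zi Pr pji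
  q : Tij.X → O → Pl.X
  qr : Tji.X → O → Pr.X
  hq : MixedMod Tij O πA Pl q
  hqr : MixedMod Tji O πA Pr qr
  q_compat : ∀ x y S, q (mij x y) S = pij x (mmj y S)
  q_compatr : ∀ y x S, qr (mji y x) S = pji y (mmi x S)
  ν : TZ.X → Pl.X
  νr : TZr.X → Pr.X
  hν : IsCLMap ν ∧ Function.Bijective ν ∧
    ∀ x S ζ, ν (mZ (mmi x S) ζ) = pij x (Zj.lactL S ζ)
  hνr : IsCLMap νr ∧ Function.Bijective νr ∧
    ∀ y S ζ, νr (mZr (mmj y S) ζ) = pji y (Zi.lactL S ζ)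
  Θ : Pl.X → Pr.X
  hΘ : IsCLMap Θ ∧ ∀ u S, Θ (q u S) = qr (θij u) S
  hR : ∀ z, νr (R z) = Θ (ν z)

namespace Corr

variable (W : Corr A)

lemma inner_add_left (x y z : W.X) : W.inner (x + y) z = W.inner x z + W.inner y z := by
  rw [← W.inner_star z, W.inner_add_right, star_add, W.inner_star, W.inner_star]

lemma inner_smul_left (c : ℂ) (x y : W.X) : W.inner (c • x) y = star c • W.inner x y := by
  rw [← W.inner_star y, W.inner_smul_right, star_smul, W.inner_star]

lemma inner_ract_left (x y : W.X) (a : A) : W.inner (W.ract x a) y = star a * W.inner x y := by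
  rw [← W.inner_star y, W.inner_ract_right, star_mul, W.inner_star]

lemma inner_neg_right (x y : W.X) : W.inner x (-y) = -W.inner x y := by
  simpa using W.inner_smul_right (-1) x y

lemma inner_neg_left (x y : W.X) : W.inner (-x) y = -W.inner x y := by
  simpa using W.inner_smul_left (-1) x y

lemma inner_sub_right (x y z : W.X) : W.inner x (y - z) = W.inner x y - W.inner x z := by
  rw [sub_eq_add_neg, W.inner_add_right, W.inner_neg_right, sub_eq_add_neg]

lemma inner_sub_left (x y z : W.X) : W.inner (x - y) z = W.inner x z - W.inner y z := by
  rw [sub_eq_add_neg, W.inner_add_left, W.inner_neg_left, sub_eq_add_neg]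

lemma inner_zero_right (x : W.X) : W.inner x 0 = 0 := by
  simpa using W.inner_smul_right 0 x 0

lemma inner_zero_left (x : W.X) : W.inner 0 x = 0 := by
  simpa using W.inner_smul_left 0 0 x

lemma inner_sum_right {ι : Type*} (s : Finset ι) (x : W.X) (f : ι → W.X) :
    W.inner x (∑ i ∈ s, f i) = ∑ i ∈ s, W.inner x (f i) := by
  classical
  induction s using Finset.induction_on with
  | empty => simp [W.inner_zero_right]
  | insert i s hi ih => rw [Finset.sum_insert hi, Finset.sum_insert hi, W.inner_add_right, ih]

lemma inner_sum_left {ι : Type*} (s : Finset ι) (x : W.X) (f : ι → W.X) :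
    W.inner (∑ i ∈ s, f i) x = ∑ i ∈ s, W.inner (f i) x := by
  rw [← W.inner_star x, W.inner_sum_right, star_sum]
  simp only [W.inner_star]

lemma ext_inner {x y : W.X} (h : ∀ z, W.inner z x = W.inner z y) : x = y := by
  have h0 : ‖x - y‖ ^ 2 = 0 := by
    rw [W.norm_eq, W.inner_sub_right, h, sub_self, norm_zero]
  exact sub_eq_zero.mp (norm_eq_zero.mp (pow_eq_zero_iff two_ne_zero |>.mp h0))

/-- A Cauchy–Schwarz inequality with a non-optimal constant; it only uses polarization and not
the positivity of the inner product. -/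
lemma norm_inner_le (x y : W.X) : ‖W.inner x y‖ ≤ 6 * ‖x‖ * ‖y‖ := by
  have unit : ∀ x y : W.X, ‖x‖ ≤ 1 → ‖y‖ ≤ 1 → ‖W.inner x y‖ ≤ 6 := by
    intro x y hx hy
    have sq : ∀ z : W.X, ∀ r : ℝ, ‖z‖ ≤ r → ‖W.inner z z‖ ≤ r ^ 2 := fun z r hz => by
      rw [← W.norm_eq]; gcongr
    have P : ∀ y : W.X, ‖y‖ ≤ 1 → ‖W.inner x y + W.inner y x‖ ≤ 6 := by
      intro y hy
      have e : W.inner x y + W.inner y x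
          = W.inner (x + y) (x + y) - W.inner x x - W.inner y y := by
        rw [W.inner_add_left, W.inner_add_right, W.inner_add_right]; abel
      have h1 := sq (x + y) 2 ((norm_add_le _ _).trans (by linarith))
      have h2 := sq x 1 hx
      have h3 := sq y 1 hy
      rw [e]
      refine (norm_sub_le _ _).trans ?_
      have := norm_sub_le (W.inner (x + y) (x + y)) (W.inner x x)
      linarith
    have hI : ‖Complex.I • y‖ ≤ 1 := by rw [norm_smul]; simpa using hy
    have e : (2 : ℂ) • W.inner x y = (W.inner x y + W.inner y x)
        - Complex.I • (W.inner x (Complex.I • y) + W.inner (Complex.I • y) x) := by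
      rw [W.inner_smul_right, W.inner_smul_left, smul_add, smul_smul, smul_smul]
      simp [two_smul]
    have h1 := P y hy
    have h2 := P _ hI
    have h3 : ‖(2 : ℂ) • W.inner x y‖ ≤ 12 := by
      rw [e]
      refine (norm_sub_le _ _).trans ?_
      rw [norm_smul, Complex.norm_I, one_mul]; linarith
    rw [norm_smul] at h3
    norm_num at h3
    linarith
  by_cases hx : x = 0
  · simp [hx, W.inner_zero_left]
  by_cases hy : y = 0
  · simp [hy, W.inner_zero_right]
  have hx' := norm_ne_zero_iff.mpr hx
  have hy' := norm_ne_zero_iff.mpr hy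
  have h := unit (((‖x‖⁻¹ : ℝ) : ℂ) • x) (((‖y‖⁻¹ : ℝ) : ℂ) • y)
    (by rw [norm_smul]; simp [hx']) (by rw [norm_smul]; simp [hy'])
  rw [W.inner_smul_left, W.inner_smul_right, norm_smul, norm_smul] at h
  simp only [norm_star, Complex.norm_real, norm_inv, norm_norm] at h
  have := mul_le_mul_of_nonneg_left h (by positivity : 0 ≤ ‖x‖ * ‖y‖)
  calc ‖W.inner x y‖ = ‖x‖ * ‖y‖ * (‖x‖⁻¹ * (‖y‖⁻¹ * ‖W.inner x y‖)) := by field_simp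
    _ ≤ ‖x‖ * ‖y‖ * 6 := this
    _ = 6 * ‖x‖ * ‖y‖ := by ring

lemma norm_ract_le (x : W.X) (a : A) : ‖W.ract x a‖ ≤ ‖a‖ * ‖x‖ := by
  refine abs_le_of_sq_le_sq' ?_ (by positivity) |>.2
  rw [W.norm_eq, W.inner_ract_right, W.inner_ract_left, mul_pow, W.norm_eq x]
  calc ‖star a * W.inner x x * a‖ ≤ ‖star a * W.inner x x‖ * ‖a‖ := norm_mul_le _ _
    _ ≤ ‖star a‖ * ‖W.inner x x‖ * ‖a‖ := by gcongr; exact norm_mul_le _ _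
    _ = ‖a‖ ^ 2 * ‖W.inner x x‖ := by rw [norm_star]; ring

/-- The inner product with a fixed left entry, as a continuous linear map. -/
def innerCLM (x : W.X) : W.X →L[ℂ] A :=
  LinearMap.mkContinuous
    { toFun := W.inner x, map_add' := W.inner_add_right x,
      map_smul' := fun c y => W.inner_smul_right c x y } (6 * ‖x‖) (W.norm_inner_le x)

/-- The right action of a fixed element, as a continuous linear map. -/
def ractCLM (a : A) : W.X →L[ℂ] W.X :=
  LinearMap.mkContinuous
    { toFun := fun x => W.ract x a, map_add' := fun x y => W.ract_add_left x y a,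
      map_smul' := fun c x => W.ract_smul c x a } ‖a‖ (fun x => W.norm_ract_le x a)

lemma continuous_inner_right (x : W.X) : Continuous (fun y => W.inner x y) :=
  (W.innerCLM x).continuous

lemma continuous_inner_left (y : W.X) : Continuous (fun x => W.inner x y) := by
  simpa only [W.inner_star] using (W.continuous_inner_right y).star

lemma continuous_ract (a : A) : Continuous (fun x => W.ract x a) :=
  (W.ractCLM a).continuous

lemma lact_ract (a b : A) (x : W.X) :
    W.lactL a (W.ract x b) = W.ract (W.lactL a x) b := by
  refine W.ext_inner fun z => ?_
  have h : ∀ y, W.inner z (W.lactL a y) = W.inner (W.lactL (star a) z) y := fun y => by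
    rw [W.lact_adjoint, star_star]
  rw [h, W.inner_ract_right, W.inner_ract_right, h]

lemma ract_sub_right (x : W.X) (a b : A) : W.ract x (a - b) = W.ract x a - W.ract x b := by
  have h := W.ract_smul' (-1) x b
  rw [sub_eq_add_neg, W.ract_add_right, sub_eq_add_neg]
  simpa using h

lemma inner_rankOne_sum {ι : Type*} (s : Finset ι) (x y : ι → W.X) (z w : W.X) :
    W.inner ((∑ r ∈ s, W.rankOne (x r) (y r)) z) w
      = W.inner z ((∑ r ∈ s, W.rankOne (y r) (x r)) w) := by
  rw [sum_apply, sum_apply, W.inner_sum_left,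
    W.inner_sum_right]
  refine Finset.sum_congr rfl fun r _ => ?_
  rw [W.rankOne_apply, W.rankOne_apply, W.inner_ract_left, W.inner_ract_right, W.inner_star]

lemma norm_rankOne_sum_swap_le {ι : Type*} (s : Finset ι) (x y : ι → W.X) :
    ‖∑ r ∈ s, W.rankOne (y r) (x r)‖ ≤ 6 * ‖∑ r ∈ s, W.rankOne (x r) (y r)‖ := by
  set K := ∑ r ∈ s, W.rankOne (x r) (y r)
  set L := ∑ r ∈ s, W.rankOne (y r) (x r)
  refine L.opNorm_le_bound (by positivity) fun z => ?_
  have h1 : ‖L z‖ ^ 2 ≤ 6 * (‖K‖ * ‖L z‖) * ‖z‖ := by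
    rw [W.norm_eq, ← W.inner_rankOne_sum s x y (L z) z]
    refine (W.norm_inner_le _ _).trans ?_
    gcongr
    exact K.le_opNorm _
  by_cases hz : ‖L z‖ = 0
  · rw [hz]; positivity
  have hz' : 0 < ‖L z‖ := lt_of_le_of_ne (norm_nonneg _) (Ne.symm hz)
  refine le_of_mul_le_mul_right ?_ hz'
  nlinarith

end Corr

/-- A bounded approximate unit of a C*-algebra, as a filter. -/
lemma exists_approximateUnit (A : Type u) [NonUnitalCStarAlgebra A] :
    ∃ l : Filter A, l.NeBot ∧ (∀ᶠ e in l, ‖e‖ ≤ 1) ∧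
      (∀ a, Tendsto (fun e => e * a) l (𝓝 a)) ∧ (∀ a, Tendsto (fun e => a * e) l (𝓝 a)) := by
  let _ := CStarAlgebra.spectralOrder A
  let _ := CStarAlgebra.spectralOrderedRing A
  have h := CStarAlgebra.increasingApproximateUnit A
  exact ⟨CStarAlgebra.approximateUnit A, h.neBot, h.eventually_norm,
    fun a => h.tendsto_mul_right a, fun a => h.tendsto_mul_left a⟩

lemma Corr.tendsto_ract (W : Corr A) {l : Filter A} (hb : ∀ᶠ e in l, ‖e‖ ≤ 1)
    (hl : ∀ a, Tendsto (fun e => a * e) l (𝓝 a)) (x : W.X) :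
    Tendsto (fun e => W.ract x e) l (𝓝 x) := by
  rw [tendsto_iff_norm_sub_tendsto_zero]
  have h0 : Tendsto (fun e => 2 * ‖W.inner x x * e - W.inner x x‖) l (𝓝 0) := by
    simpa using (tendsto_iff_norm_sub_tendsto_zero.mp (hl (W.inner x x))).const_mul 2
  have h1 : Tendsto (fun e => ‖W.ract x e - x‖ ^ 2) l (𝓝 0) := by
    refine tendsto_of_tendsto_of_tendsto_of_le_of_le' tendsto_const_nhds h0
      (Eventually.of_forall fun _ => by positivity) ?_
    filter_upwards [hb] with e he
    have e1 : W.inner (W.ract x e - x) (W.ract x e - x)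
        = star e * (W.inner x x * e - W.inner x x) - (W.inner x x * e - W.inner x x) := by
      rw [W.inner_sub_left, W.inner_sub_right, W.inner_sub_right, W.inner_ract_left,
        W.inner_ract_left, W.inner_ract_right, mul_sub]
    rw [W.norm_eq, e1]
    refine (norm_sub_le _ _).trans ?_
    have : ‖star e * (W.inner x x * e - W.inner x x)‖ ≤ 1 * ‖W.inner x x * e - W.inner x x‖ :=
      (norm_mul_le _ _).trans (by gcongr; rwa [norm_star])
    linarith
  have h2 := h1.sqrt
  simpa using h2

/-- A *-homomorphism stated elementwise, as a bundled one. -/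
def IsStarHom.toHom {π : A → B} (h : IsStarHom π) : A →⋆ₙₐ[ℂ] B where
  toFun := π
  map_smul' := h.map_smul
  map_zero' := by simpa using h.map_smul 0 0
  map_add' := h.map_add
  map_mul' := h.map_mul
  map_star' := h.map_star

lemma IsStarHom.norm_le {π : A → B} (h : IsStarHom π) (a : A) : ‖π a‖ ≤ ‖a‖ :=
  NonUnitalStarAlgHom.norm_apply_le h.toHom a

lemma IsStarHom.norm_eq {π : A → B} (h : IsStarHom π) (hi : Function.Injective π) (a : A) :
    ‖π a‖ = ‖a‖ :=
  NonUnitalStarAlgHom.norm_map h.toHom hi a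

lemma IsStarHom.continuous {π : A → B} (h : IsStarHom π) : Continuous π :=
  AddMonoidHomClass.continuous_of_bound h.toHom 1 fun a => by
    rw [one_mul]; exact h.norm_le a

lemma IsStarHom.map_sub {π : A → B} (h : IsStarHom π) (a b : A) : π (a - b) = π a - π b :=
  _root_.map_sub h.toHom a b

lemma IsStarHom.map_sum {π : A → B} (h : IsStarHom π) {ι : Type*} (s : Finset ι) (f : ι → A) :
    π (∑ i ∈ s, f i) = ∑ i ∈ s, π (f i) :=
  _root_.map_sum h.toHom f s

namespace IsRep

variable {W : Corr A} {π : A → B} {t : W.X → B}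

lemma norm_le (h : IsRep W π t) (x : W.X) : ‖t x‖ ≤ ‖x‖ := by
  refine abs_le_of_sq_le_sq' ?_ (norm_nonneg _) |>.2
  rw [sq, ← CStarRing.norm_star_mul_self, h.inner, W.norm_eq]
  exact h.hom.norm_le _

lemma norm_eq (h : IsRep W π t) (hi : Function.Injective π) (x : W.X) : ‖t x‖ = ‖x‖ := by
  have : ‖t x‖ ^ 2 = ‖x‖ ^ 2 := by
    rw [sq, ← CStarRing.norm_star_mul_self, h.inner, W.norm_eq, h.hom.norm_eq hi]
  exact (pow_left_inj₀ (norm_nonneg _) (norm_nonneg _) two_ne_zero).mp this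

/-- The second component of a representation, as a continuous linear map. -/
def toCLM (h : IsRep W π t) : W.X →L[ℂ] B :=
  LinearMap.mkContinuous
    { toFun := t, map_add' := h.t_add, map_smul' := h.t_smul } 1 (by simpa using h.norm_le)

lemma continuous (h : IsRep W π t) : Continuous t := h.toCLM.continuous

lemma map_sub (h : IsRep W π t) (x y : W.X) : t (x - y) = t x - t y :=
  _root_.map_sub h.toCLM x y

lemma map_sum (h : IsRep W π t) {ι : Type*} (s : Finset ι) (f : ι → W.X) :
    t (∑ i ∈ s, f i) = ∑ i ∈ s, t (f i) :=
  _root_.map_sum h.toCLM f s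

lemma rankOne_mul (h : IsRep W π t) (x y z : W.X) :
    t x * star (t y) * t z = t (W.rankOne x y z) := by
  rw [mul_assoc, h.inner, W.rankOne_apply, h.ract]

lemma rankOne_sum_mul (h : IsRep W π t) {ι : Type*} (s : Finset ι) (x y : ι → W.X) (z : W.X) :
    (∑ r ∈ s, t (x r) * star (t (y r))) * t z = t ((∑ r ∈ s, W.rankOne (x r) (y r)) z) := by
  rw [Finset.sum_mul, sum_apply, h.map_sum]
  exact Finset.sum_congr rfl fun r _ => h.rankOne_mul _ _ _

end IsRep

/-- The norm of a self-adjoint element is controlled by the growth of its powers. -/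
lemma norm_le_of_norm_iterate_mul_le {h : B} (hs : star h = h) {C r : ℝ} (hr : 0 ≤ r)
    (hC : ∀ m : ℕ, ‖(fun b => h * b)^[m] h‖ ≤ C * r ^ m) : ‖h‖ ≤ r := by
  have key : ∀ m : ℕ, (((fun b => h * b)^[m] h : B) : Unitization ℂ B)
      = (h : Unitization ℂ B) ^ (m + 1) := by
    intro m
    induction m with
    | zero => simp
    | succ m ih => rw [Function.iterate_succ_apply', Unitization.inr_mul, ih, ← pow_succ']
  have hsa : IsSelfAdjoint (h : Unitization ℂ B) := by
    rw [IsSelfAdjoint, ← Unitization.inr_star, hs]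
  have pw : ∀ n : ℕ, ‖h‖ ^ 2 ^ n ≤ C * r ^ (2 ^ n - 1) := by
    intro n
    have e : 2 ^ n - 1 + 1 = 2 ^ n := Nat.sub_add_cancel Nat.one_le_two_pow
    have h1 := hC (2 ^ n - 1)
    rwa [← Unitization.norm_inr (𝕜 := ℂ), key, e, hsa.norm_pow_two_pow,
      Unitization.norm_inr] at h1
  by_contra hlt
  push Not at hlt
  have hh : 0 < ‖h‖ := hr.trans_lt hlt
  have bd : ∀ n : ℕ, ‖h‖ ≤ C * (r / ‖h‖) ^ (2 ^ n - 1) := by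
    intro n
    have e : 2 ^ n = 2 ^ n - 1 + 1 := (Nat.sub_add_cancel Nat.one_le_two_pow).symm
    have h1 := pw n
    rw [e, pow_succ, Nat.add_sub_cancel] at h1
    rw [div_pow, ← mul_div_assoc, le_div_iff₀ (by positivity)]
    linarith
  have lim : Tendsto (fun n : ℕ => C * (r / ‖h‖) ^ (2 ^ n - 1)) atTop (𝓝 (C * 0)) := by
    refine Tendsto.const_mul C ?_
    refine (tendsto_pow_atTop_nhds_zero_of_lt_one (by positivity)
      ((div_lt_one hh).mpr hlt)).comp ?_
    refine tendsto_atTop_mono (fun n => ?_) tendsto_id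
    have := Nat.lt_two_pow_self (n := n)
    simp only [id]; omega
  have := ge_of_tendsto' lim bd
  linarith

namespace IsRep

variable {W : Corr A} {π : A → B} {t : W.X → B}

/-- The canonical map from finite-rank operators to the C*-algebra of a representation is
bounded. -/
lemma norm_sum_le (h : IsRep W π t) {ι : Type*} (s : Finset ι) (x y : ι → W.X) :
    ‖∑ r ∈ s, t (x r) * star (t (y r))‖ ≤ 3 * ‖∑ r ∈ s, W.rankOne (x r) (y r)‖ := by
  set K := ∑ r ∈ s, W.rankOne (x r) (y r)
  set L := ∑ r ∈ s, W.rankOne (y r) (x r)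
  set k := ∑ r ∈ s, t (x r) * star (t (y r)) with hk
  have hL : ‖L‖ ≤ 6 * ‖K‖ := W.norm_rankOne_sum_swap_le s x y
  have hkt : ∀ z, k * t z = t (K z) := h.rankOne_sum_mul s x y
  have hk' : star k = ∑ r ∈ s, t (y r) * star (t (x r)) := by
    rw [hk, star_sum]
    simp only [star_mul, star_star]
  have hLt : ∀ z, star k * t z = t (L z) := fun z => by
    rw [hk']; exact h.rankOne_sum_mul s y x z
  set H := L.comp K
  have hH : ∀ z, star k * k * t z = t (H z) := fun z => by
    rw [mul_assoc, hkt, hLt]; rfl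
  have h0 : star k * k = ∑ r ∈ s, t (L (x r)) * star (t (y r)) := by
    conv_lhs => rw [hk, Finset.mul_sum]
    exact Finset.sum_congr rfl fun r _ => by rw [← mul_assoc, hLt]
  have hp : ∀ m : ℕ, (fun b => star k * k * b)^[m] (star k * k)
      = ∑ r ∈ s, t ((H ^ m) (L (x r))) * star (t (y r)) := by
    intro m
    induction m with
    | zero => simpa using h0
    | succ m ih =>
      rw [Function.iterate_succ_apply', ih, Finset.mul_sum]
      refine Finset.sum_congr rfl fun r _ => ?_
      rw [← mul_assoc, hH, pow_succ']
      rfl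
  have main : ‖star k * k‖ ≤ ‖H‖ := by
    refine norm_le_of_norm_iterate_mul_le (C := ∑ r ∈ s, ‖L (x r)‖ * ‖y r‖)
      (by rw [star_mul, star_star]) (norm_nonneg _) fun m => ?_
    rw [hp, Finset.sum_mul]
    refine (_root_.norm_sum_le _ _).trans (Finset.sum_le_sum fun r _ => ?_)
    refine (norm_mul_le _ _).trans ?_
    rw [norm_star]
    have hm : ‖(H ^ m) (L (x r))‖ ≤ ‖H‖ ^ m * ‖L (x r)‖ := by
      refine ((H ^ m).le_opNorm _).trans ?_
      gcongr
      rcases Nat.eq_zero_or_pos m with rfl | hm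
      · rw [pow_zero, pow_zero]; exact ContinuousLinearMap.norm_id_le
      · exact norm_pow_le' H hm
    calc ‖t ((H ^ m) (L (x r)))‖ * ‖t (y r)‖ ≤ (‖H‖ ^ m * ‖L (x r)‖) * ‖y r‖ :=
          mul_le_mul ((h.norm_le _).trans hm) (h.norm_le _) (norm_nonneg _) (by positivity)
      _ = ‖L (x r)‖ * ‖y r‖ * ‖H‖ ^ m := by ring
  rw [CStarRing.norm_star_mul_self] at main
  have hHn : ‖H‖ ≤ 6 * ‖K‖ * ‖K‖ := (ContinuousLinearMap.opNorm_comp_le L K).trans (by gcongr)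
  refine abs_le_of_sq_le_sq' ?_ (by positivity) |>.2
  nlinarith [norm_nonneg K]

end IsRep

/-- The linear span of the elements `t x * (t y)⋆`. -/
def ketBra (W : Corr A) (t : W.X → B) : Submodule ℂ B :=
  Submodule.span ℂ {b : B | ∃ x y, b = t x * star (t y)}

lemma Corr.rankOne_smul_left (W : Corr A) (c : ℂ) (x y : W.X) :
    W.rankOne (c • x) y = c • W.rankOne x y := by
  ext z
  rw [smul_apply, W.rankOne_apply, W.rankOne_apply, W.ract_smul]

/-- Elements of the span of a family of products that is homogeneous in the first variable are
finite sums of such products. -/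
lemma exists_sum_of_mem_span {E F : Type*} [SMul ℂ E] [AddCommGroup F] [Module ℂ F]
    {f : E → E → F} (hf : ∀ (c : ℂ) x y, f (c • x) y = c • f x y) {z : F}
    (hz : z ∈ Submodule.span ℂ {b : F | ∃ x y, b = f x y}) :
    ∃ (N : ℕ) (x y : Fin N → E), z = ∑ r, f (x r) (y r) := by
  obtain ⟨N, c, g, rfl⟩ := Submodule.mem_span_set'.mp hz
  choose x y hxy using fun r => (g r).2
  exact ⟨N, fun r => c r • x r, y, Finset.sum_congr rfl fun r _ => by rw [hxy, hf]⟩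

lemma IsRep.ketBra_exists_sum {W : Corr A} {π : A → B} {t : W.X → B} (h : IsRep W π t) {z : B}
    (hz : z ∈ ketBra W t) :
    ∃ (N : ℕ) (x y : Fin N → W.X), z = ∑ r, t (x r) * star (t (y r)) :=
  exists_sum_of_mem_span (f := fun x y => t x * star (t y))
    (fun c x y => by rw [h.t_smul, smul_mul_assoc]) hz

lemma sum_mem_ketBra {W : Corr A} (t : W.X → B) {ι : Type*} (s : Finset ι) (x y : ι → W.X) :
    ∑ r ∈ s, t (x r) * star (t (y r)) ∈ ketBra W t :=
  Submodule.sum_mem _ fun r _ => Submodule.subset_span ⟨x r, y r, rfl⟩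

/-- The coefficient algebra is contained in the closed span of the elements `t x * (t y)⋆`. -/
def CPDense (W : Corr A) (π : A → B) (t : W.X → B) : Prop :=
  ∀ a, π a ∈ closure (ketBra W t : Set B)

lemma CPCov.cpDense {W : Corr A} {π : A → B} {t : W.X → B} (hW : W.Regular)
    (hc : CPCov W π t) : CPDense W π t := by
  intro a
  obtain ⟨u, hu, hlim⟩ := mem_closure_iff_seq_limit.mp (hW.2 a)
  choose N x y hxy using fun n => exists_sum_of_mem_span W.rankOne_smul_left (hu n)
  refine mem_closure_of_tendsto (hc a N x y ?_)
    (Eventually.of_forall fun n => sum_mem_ketBra t _ _ _)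
  simpa only [← hxy] using hlim

lemma IsRep.norm_sum_sub_sum_le {W : Corr A} {π : A → B} {t : W.X → B} (h : IsRep W π t)
    {ι κ : Type*} [Fintype ι] [Fintype κ] (x y : ι → W.X) (x' y' : κ → W.X) :
    ‖∑ r, t (x r) * star (t (y r)) - ∑ r, t (x' r) * star (t (y' r))‖
      ≤ 3 * ‖∑ r, W.rankOne (x r) (y r) - ∑ r, W.rankOne (x' r) (y' r)‖ := by
  have h2 := h.norm_sum_le (Finset.univ : Finset (ι ⊕ κ))
    (Sum.elim x (fun r => -x' r)) (Sum.elim y y')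
  have n1 : ∀ r, W.rankOne (-x' r) (y' r) = -W.rankOne (x' r) (y' r) := fun r => by
    simpa using W.rankOne_smul_left (-1) (x' r) (y' r)
  have n2 : ∀ r, t (-x' r) = -t (x' r) := fun r => by simpa using h.t_smul (-1) (x' r)
  simpa only [Fintype.sum_sum_type, Sum.elim_inl, Sum.elim_inr, n1, n2, neg_mul,
    Finset.sum_neg_distrib, ← sub_eq_add_neg] using h2

lemma CPDense.cpCov {W : Corr A} {π : A → B} {t : W.X → B} (h : IsRep W π t)
    (hi : Function.Injective π) (hd : CPDense W π t) : CPCov W π t := by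
  intro a N x y hlim
  rw [Metric.tendsto_atTop] at hlim ⊢
  intro ε hε
  obtain ⟨k, hk, hka⟩ := Metric.mem_closure_iff.mp (hd a) (ε / 10) (by positivity)
  obtain ⟨M, x', y', rfl⟩ := h.ketBra_exists_sum hk
  rw [dist_comm, dist_eq_norm] at hka
  set K := ∑ r, W.rankOne (x' r) (y' r)
  have hK : ‖K - W.lactL a‖ ≤ ε / 10 := by
    refine ContinuousLinearMap.opNorm_le_bound _ (by positivity) fun z => ?_
    rw [← h.norm_eq hi, ← h.norm_eq hi z, sub_apply, h.map_sub, ← h.rankOne_sum_mul, h.lact,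
      ← sub_mul]
    exact (norm_mul_le _ _).trans (by gcongr)
  obtain ⟨n₀, hn₀⟩ := hlim (ε / 10) (by positivity)
  refine ⟨n₀, fun n hn => ?_⟩
  have h1 := hn₀ n hn
  rw [dist_eq_norm] at h1 ⊢
  set Kn := ∑ r, W.rankOne (x n r) (y n r)
  have h2 := h.norm_sum_sub_sum_le (x n) (y n) x' y'
  have h3 : ‖Kn - K‖ ≤ ε / 10 + ε / 10 := by
    rw [← sub_add_sub_cancel _ (W.lactL a)]
    refine (norm_add_le _ _).trans (add_le_add h1.le ?_)
    rwa [← norm_neg, neg_sub]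
  rw [← sub_add_sub_cancel _ (∑ r, t (x' r) * star (t (y' r)))]
  refine (norm_add_le _ _).trans_lt ?_
  linarith

lemma CPDense.congr_iso {W V : Corr A} {π : A → B} {t : W.X → B} (e : CorrIso W V)
    (h : CPDense W π t) : CPDense V π (fun v => t (e.invFun v)) := by
  refine fun a => closure_mono (Submodule.span_mono ?_) (h a)
  rintro _ ⟨x, y, rfl⟩
  exact ⟨e.toFun x, e.toFun y, by simp only [e.left_inv]⟩

lemma IsRep.congr_iso {W V : Corr A} {π : A → B} {t : W.X → B} (e : CorrIso W V)
    (h : IsRep W π t) : IsRep V π (fun v => t (e.invFun v)) where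
  hom := h.hom
  t_add x y := by
    rw [← h.t_add, ← e.left_inv (_ + _), e.map_add, e.right_inv, e.right_inv]
  t_smul c x := by
    rw [← h.t_smul, ← e.left_inv (c • _), e.map_smul, e.right_inv]
  lact a x := by
    rw [← h.lact, ← e.left_inv (W.lactL _ _), e.map_lact, e.right_inv]
  ract x a := by
    rw [← h.ract, ← e.left_inv (W.ract _ _), e.map_ract, e.right_inv]
  inner x y := by
    rw [h.inner, ← e.map_inner, e.right_inv, e.right_inv]

/-- Two continuous linear maps agreeing on the elementary tensors coincide. -/
lemma IsTensor.clm_ext {W V T : Corr A} {m : W.X → V.X → T.X} (hT : IsTensor W V T m)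
    {E : Type*} [NormedAddCommGroup E] [NormedSpace ℂ E] {f g : T.X →L[ℂ] E}
    (h : ∀ x y, f (m x y) = g (m x y)) : f = g := by
  refine ContinuousLinearMap.ext_on (dense_iff_closure_eq.mpr hT.dense) ?_
  rintro _ ⟨x, y, rfl⟩
  exact h x y

lemma IsTensor.isRep_ext {W V T : Corr A} {m : W.X → V.X → T.X} (hT : IsTensor W V T m)
    {π : A → B} {v w : T.X → B} (hv : IsRep T π v) (hw : IsRep T π w)
    (h : ∀ x y, v (m x y) = w (m x y)) (z : T.X) : v z = w z :=
  DFunLike.congr_fun (hT.clm_ext (f := hv.toCLM) (g := hw.toCLM) h) z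

/-- Representations of the factors induce a representation of the tensor product. -/
lemma IsTensor.exists_isRep {W V T : Corr A} {m : W.X → V.X → T.X} (hT : IsTensor W V T m)
    {π : A → B} {t : W.X → B} {u : V.X → B} (ht : IsRep W π t) (hu : IsRep V π u) :
    ∃ v : T.X → B, IsRep T π v ∧ ∀ x y, v (m x y) = t x * u y := by
  let L : ((W.X × V.X) →₀ ℂ) →ₗ[ℂ] T.X := Finsupp.linearCombination ℂ fun p => m p.1 p.2
  let M : ((W.X × V.X) →₀ ℂ) →ₗ[ℂ] B := Finsupp.linearCombination ℂ fun p => t p.1 * u p.2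
  have hL : ∀ p c, L (Finsupp.single p c) = c • m p.1 p.2 := fun p c =>
    Finsupp.linearCombination_single ..
  have hM : ∀ p c, M (Finsupp.single p c) = c • (t p.1 * u p.2) := fun p c =>
    Finsupp.linearCombination_single ..
  have hinner : ∀ f g, star (M f) * M g = π (T.inner (L f) (L g)) := by
    intro f g
    induction f using Finsupp.induction_linear with
    | zero =>
      rw [_root_.map_zero, _root_.map_zero, T.inner_zero_left, star_zero, zero_mul]
      exact (map_zero hu.hom.toHom).symm
    | add f f' hf hf' =>
      rw [_root_.map_add, _root_.map_add, star_add, add_mul, hf, hf', T.inner_add_left,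
        hu.hom.map_add]
    | single p c =>
      induction g using Finsupp.induction_linear with
      | zero =>
        rw [_root_.map_zero M, _root_.map_zero L, T.inner_zero_right, mul_zero]
        exact (map_zero hu.hom.toHom).symm
      | add g g' hg hg' =>
        rw [_root_.map_add M, _root_.map_add L, mul_add, hg, hg', T.inner_add_right,
          hu.hom.map_add]
      | single q d =>
        rw [hL, hL, hM, hM, T.inner_smul_left, T.inner_smul_right, hu.hom.map_smul,
          hu.hom.map_smul, hT.inner, star_smul, smul_mul_assoc, mul_smul_comm, star_mul,
          ← hu.inner, hu.lact, ← ht.inner]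
        simp only [mul_assoc]
  have hnorm : ∀ f, ‖M f‖ ≤ 1 * ‖L f‖ := by
    intro f
    rw [one_mul]
    refine abs_le_of_sq_le_sq' ?_ (norm_nonneg _) |>.2
    rw [sq, ← CStarRing.norm_star_mul_self, hinner, T.norm_eq]
    exact hu.hom.norm_le _
  have hd : DenseRange L := by
    rw [denseRange_iff_closure_range, ← hT.dense]
    congr 1
    have : (LinearMap.range L : Set T.X) = _ :=
      congrArg _ (Finsupp.range_linearCombination ℂ (v := fun p : W.X × V.X => m p.1 p.2))
    rw [LinearMap.coe_range] at this
    rw [this]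
    congr 2
    ext z
    simp [eq_comm]
  let v := M.extendOfNorm L
  have hv : ∀ f, v (L f) = M f := LinearMap.extendOfNorm_eq hd ⟨1, hnorm⟩
  have hvm : ∀ x y, v (m x y) = t x * u y := fun x y => by
    have := hv (Finsupp.single (x, y) 1)
    rwa [hL, hM, one_smul, one_smul] at this
  refine ⟨v, ⟨hu.hom, v.map_add, v.map_smul, fun a z => ?_, fun z a => ?_, fun z w => ?_⟩, hvm⟩
  · refine DFunLike.congr_fun (hT.clm_ext (f := v.comp (T.lactL a))
      (g := (ContinuousLinearMap.mul ℂ B (π a)).comp v) fun x y => ?_) z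
    change v (T.lactL a (m x y)) = π a * v (m x y)
    rw [hT.lact, hvm, hvm, ht.lact, mul_assoc]
  · refine DFunLike.congr_fun (hT.clm_ext (f := v.comp (T.ractCLM a))
      (g := ((ContinuousLinearMap.mul ℂ B).flip (π a)).comp v) fun x y => ?_) z
    change v (T.ract (m x y) a) = v (m x y) * π a
    rw [hT.ract, hvm, hvm, hu.ract, mul_assoc]
  · have h1 : ∀ f, star (v z) * v (L f) = π (T.inner z (L f)) := fun f => by
      refine hd.induction_on (p := fun z => star (v z) * v (L f) = π (T.inner z (L f))) z
        (isClosed_eq (by fun_prop)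
          (hu.hom.continuous.comp (T.continuous_inner_left _))) fun g => ?_
      rw [hv, hv, hinner]
    refine hd.induction_on (p := fun w => star (v z) * v w = π (T.inner z w)) w
      (isClosed_eq (by fun_prop)
        (hu.hom.continuous.comp (T.continuous_inner_right _))) h1

/-- Density passes to tensor products. -/
lemma IsTensor.cpDense {W V T : Corr A} {m : W.X → V.X → T.X}
    {π : A → B} {t : W.X → B} {u : V.X → B} {v : T.X → B} (ht : IsRep W π t)
    (hv : ∀ x y, v (m x y) = t x * u y)
    (hdt : CPDense W π t) (hdu : CPDense V π u) : CPDense T π v := by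
  obtain ⟨l, hl, hb, -, hr⟩ := exists_approximateUnit A
  set J := (ketBra T v).topologicalClosure with hJ
  have hclosed : IsClosed (J : Set B) := Submodule.isClosed_topologicalClosure _
  have h1 : ∀ x y, ∀ b ∈ closure (ketBra V u : Set B), t x * b * star (t y) ∈ J := by
    intro x y b hb
    let f : B →L[ℂ] B := ((ContinuousLinearMap.mul ℂ B).flip (star (t y))).comp
      (ContinuousLinearMap.mul ℂ B (t x))
    have hle : ketBra V u ≤ J.comap f.toLinearMap := by
      refine Submodule.span_le.mpr ?_
      rintro _ ⟨p, q, rfl⟩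
      refine Submodule.le_topologicalClosure _ (Submodule.subset_span ⟨m x p, m y q, ?_⟩)
      change t x * (u p * star (u q)) * star (t y) = _
      rw [hv, hv, star_mul]
      simp only [mul_assoc]
    exact closure_minimal hle (hclosed.preimage f.continuous) hb
  have h2 : (ketBra W t : Set B) ⊆ J := by
    refine Submodule.span_le.mpr ?_
    rintro _ ⟨x, y, rfl⟩
    have hlim : Tendsto (fun e => t x * π e * star (t y)) l (𝓝 (t x * star (t y))) := by
      simp only [← ht.ract]
      exact ((ht.continuous.tendsto x).comp (W.tendsto_ract hb hr x)).mul_const _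
    exact hclosed.mem_of_tendsto hlim (Eventually.of_forall fun e => h1 x y _ (hdu e))
  exact fun a => closure_minimal h2 hclosed (hdt a)

namespace IsTensor

variable {W V T : Corr A} {m : W.X → V.X → T.X} {π : A → B} {u : V.X → B}

lemma norm_le (hT : IsTensor W V T m) (hi : Function.Injective π) (hu : IsRep V π u)
    (x : W.X) (y : V.X) : ‖m x y‖ ≤ ‖x‖ * ‖y‖ := by
  refine abs_le_of_sq_le_sq' ?_ (by positivity) |>.2
  rw [T.norm_eq, hT.inner, ← hu.hom.norm_eq hi, ← hu.inner, hu.lact, ← mul_assoc]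
  calc ‖star (u y) * π (W.inner x x) * u y‖
      ≤ ‖star (u y)‖ * ‖π (W.inner x x)‖ * ‖u y‖ :=
        (norm_mul_le _ _).trans (by gcongr; exact norm_mul_le _ _)
    _ ≤ ‖y‖ * ‖W.inner x x‖ * ‖y‖ := by
        rw [norm_star, hu.hom.norm_eq hi, hu.norm_eq hi]
    _ = (‖x‖ * ‖y‖) ^ 2 := by rw [← W.norm_eq]; ring

/-- Tensoring on the left with a fixed vector. -/
def mulLeft (hT : IsTensor W V T m) (hi : Function.Injective π) (hu : IsRep V π u) (x : W.X) :
    V.X →L[ℂ] T.X :=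
  LinearMap.mkContinuous
    { toFun := m x, map_add' := hT.add_right x, map_smul' := fun c y => hT.smul_right c x y }
    ‖x‖ (hT.norm_le hi hu x)

/-- Tensoring on the right with a fixed vector. -/
def mulRight (hT : IsTensor W V T m) (hi : Function.Injective π) (hu : IsRep V π u) (y : V.X) :
    W.X →L[ℂ] T.X :=
  LinearMap.mkContinuous
    { toFun := fun x => m x y, map_add' := fun x x' => hT.add_left x x' y,
      map_smul' := fun c x => hT.smul_left c x y }
    ‖y‖ (fun x => by rw [mul_comm]; exact hT.norm_le hi hu x y)

end IsTensor

lemma egen_induction {P : (Fin 2 → ℕ) → Prop} (zero : P 0)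
    (step : ∀ i s, P s → P (egen i + s)) (s : Fin 2 → ℕ) : P s := by
  have h1 : ∀ n : ℕ, P ![0, n] := fun n => by
    induction n with
    | zero => convert zero using 1; ext i; fin_cases i <;> rfl
    | succ n ih =>
      convert step 1 _ ih using 1
      ext i; fin_cases i <;> simp [egen, add_comm]
  have h0 : ∀ m n : ℕ, P ![m, n] := fun m n => by
    induction m with
    | zero => exact h1 n
    | succ m ih =>
      convert step 0 _ ih using 1
      ext i; fin_cases i <;> simp [egen, add_comm]
  convert h0 (s 0) (s 1) using 1
  ext i; fin_cases i <;> rfl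

/-- Recursive construction of a family indexed by `ℕ²`, adding the first generator last. -/
lemma exists_family_egen {P : (Fin 2 → ℕ) → Type*} (p₀ : P 0)
    (f : ∀ i s, P s → P (egen i + s)) :
    ∃ ψ : ∀ s, P s, ψ 0 = p₀ ∧ (∀ s, ψ (egen 0 + s) = f 0 s (ψ s)) ∧
      ∀ s, s 0 = 0 → ψ (egen 1 + s) = f 1 s (ψ s) := by
  let F : ℕ → ℕ → (Fin 2 → ℕ) := fun m n =>
    Nat.rec (Nat.rec 0 (fun _ s => egen 1 + s) n) (fun _ s => egen 0 + s) m
  let E : ∀ m n, P (F m n) := fun m n =>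
    Nat.rec (motive := fun m => P (F m n))
      (Nat.rec (motive := fun n => P (F 0 n)) p₀ (fun n p => f 1 (F 0 n) p) n)
      (fun m p => f 0 (F m n) p) m
  have hF0 : ∀ n, F 0 n = ![0, n] := fun n => by
    induction n with
    | zero => ext i; fin_cases i <;> rfl
    | succ n ih =>
      change egen 1 + F 0 n = _
      rw [ih]; ext i; fin_cases i <;> simp [egen, add_comm]
  have hF : ∀ m n, F m n = ![m, n] := fun m n => by
    induction m with
    | zero => exact hF0 n
    | succ m ih =>
      change egen 0 + F m n = _
      rw [ih]; ext i; fin_cases i <;> simp [egen, add_comm]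
  have hs : ∀ s, F (s 0) (s 1) = s := fun s => by
    rw [hF]; ext i; fin_cases i <;> rfl
  have hE : ∀ m n m' n' (h : F m n = F m' n'), m = m' → n = n' → h ▸ E m n = E m' n' := by
    rintro m n _ _ h rfl rfl; rfl
  let ψ : ∀ s, P s := fun s => hs s ▸ E (s 0) (s 1)
  have hψ : ∀ m n, ψ (F m n) = E m n := fun m n =>
    hE _ _ _ _ _ (by rw [hF]; rfl) (by rw [hF]; rfl)
  refine ⟨ψ, hψ 0 0, fun s => ?_, fun s h => ?_⟩
  · rw [← hs s]
    generalize s 0 = m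
    generalize s 1 = n
    rw [hψ]
    exact hψ (m + 1) n
  · rw [← hs s, h]
    generalize s 1 = n
    rw [hψ]
    exact hψ 0 (n + 1)

namespace PSys

lemma congr_heq {k : ℕ} (Xs : PSys A k) {C : Type*} (ψ : ∀ s, (Xs.fib s).X → C)
    {s s' : Fin k → ℕ}     (hs : s = s') {x : (Xs.fib s).X} {x' : (Xs.fib s').X} (hx : HEq x x') :
    ψ s x = ψ s' x' := by
  subst hs
  rw [eq_of_heq hx]

/-- The family `ψ` is multiplicative on the fibers over `s` and `t`. -/
def MulAt {k : ℕ} (Xs : PSys A k) (ψ : ∀ s, (Xs.fib s).X → B) (s t : Fin k → ℕ) : Prop :=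
  ∀ x y, ψ s x * ψ t y = ψ (s + t) (Xs.mul s t x y)

variable {k : ℕ} {Xs : PSys A k} {ψ : ∀ s, (Xs.fib s).X → B} {π : A → B}

lemma MulAt.add_left (hi : Function.Injective π) (hψ : ∀ s, IsRep (Xs.fib s) π (ψ s))
    {s t u : Fin k → ℕ} (h1 : Xs.MulAt ψ s t) (h2 : Xs.MulAt ψ t u)
    (h3 : Xs.MulAt ψ s (t + u)) : Xs.MulAt ψ (s + t) u := by
  intro z y
  refine DFunLike.congr_fun ((Xs.isTensor s t).clm_ext
    (f := ((ContinuousLinearMap.mul ℂ B).flip (ψ u y)).comp (hψ (s + t)).toCLM)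
    (g := (hψ (s + t + u)).toCLM.comp ((Xs.isTensor (s + t) u).mulRight hi (hψ u) y))
    fun a b => ?_) z
  change ψ (s + t) (Xs.mul s t a b) * ψ u y = ψ (s + t + u) (Xs.mul (s + t) u (Xs.mul s t a b) y)
  rw [← h1, mul_assoc, h2, h3]
  exact (Xs.congr_heq ψ (add_assoc s t u) (Xs.assoc s t u a b y)).symm

lemma MulAt.add_right (hi : Function.Injective π) (hψ : ∀ s, IsRep (Xs.fib s) π (ψ s))
    {s t u : Fin k → ℕ} (h1 : Xs.MulAt ψ s t) (h2 : Xs.MulAt ψ t u)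
    (h3 : Xs.MulAt ψ (s + t) u) : Xs.MulAt ψ s (t + u) := by
  intro x z
  refine DFunLike.congr_fun ((Xs.isTensor t u).clm_ext
    (f := (ContinuousLinearMap.mul ℂ B (ψ s x)).comp (hψ (t + u)).toCLM)
    (g := (hψ (s + (t + u))).toCLM.comp
      ((Xs.isTensor s (t + u)).mulLeft hi (hψ (t + u)) x))
    fun a b => ?_) z
  change ψ s x * ψ (t + u) (Xs.mul t u a b) = ψ (s + (t + u)) (Xs.mul s (t + u) x (Xs.mul t u a b))
  rw [← h2, ← mul_assoc, h1, h3]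
  exact Xs.congr_heq ψ (add_assoc s t u) (Xs.assoc s t u x a b)

/-- Commuting representations of the generating fibers of a product system over `ℕ²` extend to a
representation of the product system. -/
theorem exists_psRep {Xs : PSys A 2} (hi : Function.Injective π) (hπ : IsStarHom π)
    (ρ : ∀ i : Fin 2, (Xs.fib (egen i)).X → B)
    (hρ : ∀ i, IsRep (Xs.fib (egen i)) π (ρ i))
    (hcomm : ∀ v : (Xs.fib (egen 0 + egen 1)).X → B, IsRep _ π v →
      (∀ x y, v (Xs.mul _ _ x y) = ρ 0 x * ρ 1 y) →
      ∀ y x z, HEq z (Xs.mul (egen 1) (egen 0) y x) → v z = ρ 1 y * ρ 0 x) :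
    ∃ r : PSRep Xs B, r.π = π ∧ ∀ i, r.ψ (egen i) = ρ i := by
  have hsurj := Xs.unit_bij.surjective
  let inv := Function.surjInv hsurj
  have inv_unit : ∀ a, inv (Xs.unit a) = a := Function.leftInverse_surjInv Xs.unit_bij
  have h0 : IsRep (Xs.fib 0) π fun z => π (inv z) := by
    refine ⟨hπ, fun x y => ?_, fun c x => ?_, fun a x => ?_, fun x a => ?_, fun x y => ?_⟩
    all_goals obtain ⟨b, rfl⟩ := hsurj x
    · obtain ⟨b', rfl⟩ := hsurj y
      rw [← Xs.unit_add, inv_unit, inv_unit, inv_unit, hπ.map_add]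
    · rw [← Xs.unit_smul, inv_unit, inv_unit, hπ.map_smul]
    · rw [Xs.unit_lact, inv_unit, inv_unit, hπ.map_mul]
    · rw [Xs.unit_ract, inv_unit, inv_unit, hπ.map_mul]
    · obtain ⟨b', rfl⟩ := hsurj y
      rw [Xs.unit_inner, inv_unit, inv_unit, hπ.map_mul, hπ.map_star]
  have hext : ∀ i s (u : {u : (Xs.fib s).X → B // IsRep (Xs.fib s) π u}),
      ∃ v : {v : (Xs.fib (egen i + s)).X → B // IsRep (Xs.fib (egen i + s)) π v},
        ∀ x y, v.1 (Xs.mul (egen i) s x y) = ρ i x * u.1 y := fun i s u => by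
    obtain ⟨v, hv, h⟩ := (Xs.isTensor (egen i) s).exists_isRep (hρ i) u.2
    exact ⟨⟨v, hv⟩, h⟩
  choose f hf using hext
  obtain ⟨Ψ, hΨ0, hΨe0, hΨe1⟩ := exists_family_egen
    (P := fun s => {u : (Xs.fib s).X → B // IsRep (Xs.fib s) π u}) ⟨_, h0⟩ f
  set ψ : ∀ s, (Xs.fib s).X → B := fun s => (Ψ s).1 with hψdef
  have hψ : ∀ s, IsRep (Xs.fib s) π (ψ s) := fun s => (Ψ s).2
  have unit : ∀ a, ψ 0 (Xs.unit a) = π a := fun a => by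
    simp only [hψdef, hΨ0, inv_unit]
  have step0 : ∀ s x y, ψ (egen 0 + s) (Xs.mul (egen 0) s x y) = ρ 0 x * ψ s y :=
    fun s x y => by simp only [hψdef, hΨe0, hf]
  have step1 : ∀ s, s 0 = 0 → ∀ x y,
      ψ (egen 1 + s) (Xs.mul (egen 1) s x y) = ρ 1 x * ψ s y :=
    fun s hs x y => by simp only [hψdef, hΨe1 s hs, hf]
  have gens : ∀ i, ψ (egen i) = ρ i := by
    intro i
    have hstep : ∀ x y, ψ (egen i + 0) (Xs.mul (egen i) 0 x y) = ρ i x * ψ 0 y := by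
      fin_cases i
      · exact step0 0
      · exact step1 0 rfl
    obtain ⟨l, hl, hb, -, hr⟩ := exists_approximateUnit A
    funext x
    have hx := (Xs.fib (egen i)).tendsto_ract hb hr x
    refine tendsto_nhds_unique (((hψ _).continuous.tendsto x).comp hx) ?_
    refine (((hρ i).continuous.tendsto x).comp hx).congr fun e => ?_
    change ρ i _ = ψ _ _
    rw [(hρ i).ract, ← unit, ← hstep]
    exact Xs.congr_heq ψ (add_zero _) (Xs.unit_mul_right _ x e)
  have mul_zero_left : ∀ t, Xs.MulAt ψ 0 t := fun t x y => by
    obtain ⟨a, rfl⟩ := hsurj x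
    rw [unit, ← (hψ t).lact]
    exact (Xs.congr_heq ψ (zero_add t) (Xs.unit_mul_left t a y)).symm
  have mul_e0 : ∀ t, Xs.MulAt ψ (egen 0) t := fun t x y => by rw [step0, gens]
  have mul_e1_e0 : Xs.MulAt ψ (egen 1) (egen 0) := fun y x => by
    have hc : egen 1 + egen 0 = (egen 0 + egen 1 : Fin 2 → ℕ) := add_comm _ _
    obtain ⟨z, hz⟩ : ∃ z : (Xs.fib (egen 0 + egen 1)).X,
        HEq z (Xs.mul (egen 1) (egen 0) y x) := by
      rw [← hc]; exact ⟨_, HEq.rfl⟩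
    rw [gens, gens, ← hcomm (ψ _) (hψ _) (fun a b => by rw [← gens, ← gens, mul_e0]) y x z hz]
    exact Xs.congr_heq ψ hc.symm hz
  have mul_e1 : ∀ (m : ℕ) t, t 0 = m → Xs.MulAt ψ (egen 1) t := by
    intro m
    induction m with
    | zero => exact fun t ht x y => by rw [step1 t ht, gens]
    | succ m ih =>
      intro t ht
      obtain ⟨s, hs, rfl⟩ : ∃ s : Fin 2 → ℕ, s 0 = m ∧ t = egen 0 + s :=
        ⟨![m, t 1], rfl, by ext i; fin_cases i <;> simp [egen, ht, add_comm]⟩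
      have h01 : Xs.MulAt ψ (egen 1 + egen 0) s := by
        rw [add_comm]
        exact (mul_e0 _).add_left hi hψ (ih s hs) (mul_e0 _)
      exact mul_e1_e0.add_right hi hψ (mul_e0 s) h01
  have mul_all : ∀ s t, Xs.MulAt ψ s t := by
    intro s
    have he : ∀ i t, Xs.MulAt ψ (egen i) t := fun i t => by
      fin_cases i
      · exact mul_e0 t
      · exact mul_e1 _ t rfl
    induction s using egen_induction with
    | zero => exact mul_zero_left
    | step i s ih => exact fun t => (he i s).add_left hi hψ (ih t) (he i _)
  exact ⟨⟨π, ψ, hψ, unit, mul_all⟩, rfl, gens⟩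

end PSys

lemma PSRep.cpDense {Xs : PSys A 2} (r : PSRep Xs B)
    (h : ∀ i, CPDense (Xs.fib (egen i)) r.π (r.ψ (egen i))) (s : Fin 2 → ℕ) :
    CPDense (Xs.fib s) r.π (r.ψ s) := by
  induction s using egen_induction with
  | zero =>
    obtain ⟨l, hl, hb, -, hr⟩ := exists_approximateUnit A
    intro a
    have hlim := ((r.isRep 0).hom.continuous.tendsto a).comp (hr a)
    refine mem_closure_of_tendsto hlim (Eventually.of_forall fun e => ?_)
    refine Submodule.subset_span ⟨Xs.unit a, Xs.unit (star e), ?_⟩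
    simp only [r.ψ_zero, (r.isRep 0).hom.map_star, star_star, Function.comp_apply,
      (r.isRep 0).hom.map_mul]
  | step i s ih =>
    exact IsTensor.cpDense (r.isRep (egen i)) (fun x y => (r.mul _ _ x y).symm) (h i) ih

lemma PSRep.ext_egen {Xs : PSys A 2} {r r' : PSRep Xs B} (hπ : r.π = r'.π)
    (h : ∀ i x, r.ψ (egen i) x = r'.ψ (egen i) x) (s : Fin 2 → ℕ) :
    ∀ x, r.ψ s x = r'.ψ s x := by
  induction s using egen_induction with
  | zero =>
    intro x
    obtain ⟨a, rfl⟩ := Xs.unit_bij.surjective x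
    rw [r.ψ_zero, r'.ψ_zero, hπ]
  | step i s ih =>
    refine (Xs.isTensor (egen i) s).isRep_ext (r.isRep _) (hπ ▸ r'.isRep _) fun x y => ?_
    rw [← r.mul, ← r'.mul, h, ih]

/-- Images of an approximate unit act as a left approximate unit on the Cuntz–Pimsner algebra. -/
lemma CPAlg.tendsto_pi_mul {W : Corr A} (C : CPAlg W) (hW : W.Nondeg) {l : Filter A}
    (hb : ∀ᶠ e in l, ‖e‖ ≤ 1) (hl : ∀ a, Tendsto (fun e => e * a) l (𝓝 a)) (S : C.O) :
    Tendsto (fun e => C.π e * S) l (𝓝 S) := by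
  have hclosed : IsClosed {b : C.O | Tendsto (fun e => C.π e * b) l (𝓝 b)} := by
    refine isClosed_of_closure_subset fun b hbc => ?_
    rw [Set.mem_ofPred_eq, Metric.tendsto_nhds]
    intro ε hε
    obtain ⟨d, hd, hbd⟩ := Metric.mem_closure_iff.mp hbc (ε / 4) (by positivity)
    filter_upwards [hb, Metric.tendsto_nhds.mp hd (ε / 4) (by positivity)] with e he hed
    rw [dist_eq_norm] at hbd hed ⊢
    have h1 : ‖C.π e * (b - d)‖ ≤ 1 * ‖b - d‖ :=
      (norm_mul_le _ _).trans (by gcongr; exact (C.isRep.hom.norm_le e).trans he)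
    have h2 : C.π e * b - b = C.π e * (b - d) + (C.π e * d - d) - (b - d) := by
      rw [mul_sub]; abel
    rw [h2]
    have h3 := norm_sub_le (C.π e * (b - d) + (C.π e * d - d)) (b - d)
    have h4 := norm_add_le (C.π e * (b - d)) (C.π e * d - d)
    linarith
  have hadd : ∀ b d : C.O, Tendsto (fun e => C.π e * b) l (𝓝 b) →
      Tendsto (fun e => C.π e * d) l (𝓝 d) →
      Tendsto (fun e => C.π e * (b + d)) l (𝓝 (b + d)) := fun b d h1 h2 => by
    simpa only [mul_add] using h1.add h2
  have hsmul : ∀ (c : ℂ) (b : C.O), Tendsto (fun e => C.π e * b) l (𝓝 b) →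
      Tendsto (fun e => C.π e * (c • b)) l (𝓝 (c • b)) := fun c b h1 => by
    simpa only [mul_smul_comm] using h1.const_smul c
  have hmul : ∀ b d : C.O, Tendsto (fun e => C.π e * b) l (𝓝 b) →
      Tendsto (fun e => C.π e * (b * d)) l (𝓝 (b * d)) := fun b d h1 => by
    simpa only [mul_assoc] using h1.mul_const d
  have hpi : ∀ a, Tendsto (fun e => C.π e * C.π a) l (𝓝 (C.π a)) := fun a => by
    simpa only [Function.comp_def, C.isRep.hom.map_mul] using
      (C.isRep.hom.continuous.tendsto a).comp (hl a)
  have hlt : ∀ x, Tendsto (fun e => C.π e * C.t x) l (𝓝 (C.t x)) := by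
    let V : Submodule ℂ W.X :=
      { carrier := {x | Tendsto (fun e => C.π e * C.t x) l (𝓝 (C.t x))}
        add_mem' := fun {x y} hx hy => by
          rw [Set.mem_ofPred_eq, C.isRep.t_add]; exact hadd _ _ hx hy
        zero_mem' := by
          have h0 : C.t 0 = 0 := by simpa using C.isRep.t_smul 0 0
          rw [Set.mem_ofPred_eq, h0]; simpa only [mul_zero] using tendsto_const_nhds
        smul_mem' := fun c x hx => by
          rw [Set.mem_ofPred_eq, C.isRep.t_smul]; exact hsmul c _ hx }
    have hV : Submodule.span ℂ {y : W.X | ∃ a x, y = W.lactL a x} ≤ V := by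
      refine Submodule.span_le.mpr ?_
      rintro _ ⟨a, x, rfl⟩
      change Tendsto (fun e => C.π e * C.t (W.lactL a x)) l (𝓝 (C.t (W.lactL a x)))
      rw [C.isRep.lact]
      exact hmul _ _ (hpi a)
    intro x
    have hx : x ∈ closure (Submodule.span ℂ {y : W.X | ∃ a x, y = W.lactL a x} : Set W.X) := by
      rw [hW]; trivial
    exact closure_minimal hV (hclosed.preimage C.isRep.continuous) hx
  have hstar : ∀ x, Tendsto (fun e => C.π e * star (C.t x)) l (𝓝 (star (C.t x))) := by
    obtain ⟨k, hk, hkb, -, hkr⟩ := exists_approximateUnit A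
    intro x
    refine hclosed.mem_of_tendsto
      (((C.isRep.continuous.star).tendsto x).comp (W.tendsto_ract hkb hkr x))
      (Eventually.of_forall fun a => ?_)
    change Tendsto (fun e => C.π e * star (C.t (W.ract x a))) l (𝓝 (star (C.t (W.ract x a))))
    rw [C.isRep.ract, star_mul, ← C.isRep.hom.map_star]
    exact hmul _ _ (hpi _)
  refine (C.gen ({b : C.O | Tendsto (fun e => C.π e * b) l (𝓝 b)} ∩
    {b : C.O | Tendsto (fun e => C.π e * star b) l (𝓝 (star b))})
    (hclosed.inter (hclosed.preimage continuous_star)) ?_ ?_ ?_ ?_ ?_ ?_ S).1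
  · refine fun a => ⟨hpi a, ?_⟩
    rw [Set.mem_ofPred_eq, ← C.isRep.hom.map_star]
    exact hpi _
  · exact fun x => ⟨hlt x, hstar x⟩
  · refine fun p q hp hq => ⟨hadd _ _ hp.1 hq.1, ?_⟩
    rw [Set.mem_ofPred_eq, star_add]
    exact hadd _ _ hp.2 hq.2
  · refine fun p q hp hq => ⟨hmul _ _ hp.1, ?_⟩
    rw [Set.mem_ofPred_eq, star_mul]
    exact hmul _ _ hq.2
  · refine fun c p hp => ⟨hsmul _ _ hp.1, ?_⟩
    rw [Set.mem_ofPred_eq, star_smul]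
    exact hsmul _ _ hp.2
  · refine fun p hp => ⟨hp.2, ?_⟩
    rw [Set.mem_ofPred_eq, star_star]
    exact hp.1

namespace MixedMod

variable {W : Corr A} {π : A → B} {Z : Corr B} {m : W.X → B → Z.X}

lemma norm_pi_le (h : MixedMod W B π Z m) (hπ : IsStarHom π) (x : W.X) (a : A) :
    ‖m x (π a)‖ ≤ ‖W.ract x a‖ := by
  refine abs_le_of_sq_le_sq' ?_ (norm_nonneg _) |>.2
  rw [Z.norm_eq, W.norm_eq, h.inner, W.inner_ract_left, W.inner_ract_right, ← hπ.map_star,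
    ← hπ.map_mul, ← hπ.map_mul]
  exact hπ.norm_le _

lemma norm_le (h : MixedMod W B π Z m) (hπ : IsStarHom π) (x : W.X) (S : B) :
    ‖m x S‖ ≤ ‖x‖ * ‖S‖ := by
  refine abs_le_of_sq_le_sq' ?_ (by positivity) |>.2
  rw [Z.norm_eq, h.inner]
  calc ‖star S * (π (W.inner x x) * S)‖
      ≤ ‖star S‖ * (‖π (W.inner x x)‖ * ‖S‖) :=
        (norm_mul_le _ _).trans (by gcongr; exact norm_mul_le _ _)
    _ ≤ ‖S‖ * (‖W.inner x x‖ * ‖S‖) := by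
        rw [norm_star]; gcongr; exact hπ.norm_le _
    _ = (‖x‖ * ‖S‖) ^ 2 := by rw [← W.norm_eq]; ring

/-- The map `x ↦ x ⊗ S`. -/
def tmulRight (h : MixedMod W B π Z m) (hπ : IsStarHom π) (S : B) : W.X →L[ℂ] Z.X :=
  LinearMap.mkContinuous
    { toFun := fun x => m x S, map_add' := fun x y => h.add_left x y S,
      map_smul' := fun c x => h.smul_left c x S }
    ‖S‖ (fun x => by rw [mul_comm]; exact h.norm_le hπ x S)

/-- The map `S ↦ x ⊗ S`. -/
def tmulLeft (h : MixedMod W B π Z m) (hπ : IsStarHom π) (x : W.X) : B →L[ℂ] Z.X :=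
  LinearMap.mkContinuous
    { toFun := m x, map_add' := h.add_right x, map_smul' := fun c S => h.smul_right c x S }
    ‖x‖ (h.norm_le hπ x)

/-- Two continuous linear maps agreeing on the elementary tensors coincide. -/
lemma clm_ext (h : MixedMod W B π Z m)
    {E : Type*} [NormedAddCommGroup E] [NormedSpace ℂ E] {f g : Z.X →L[ℂ] E}
    (hfg : ∀ x S, f (m x S) = g (m x S)) : f = g := by
  refine ContinuousLinearMap.ext_on (dense_iff_closure_eq.mpr h.dense) ?_
  rintro _ ⟨x, y, rfl⟩
  exact hfg x y

/-- The multiplier `S ↦ x ⊗ S` is represented by a vector `x ⊗ 1`. -/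
lemma exists_tmul_one (h : MixedMod W B π Z m) (hπ : IsStarHom π) {l : Filter A} [l.NeBot]
    (hb : ∀ᶠ e in l, ‖e‖ ≤ 1) (hr : ∀ a, Tendsto (fun e => a * e) l (𝓝 a))
    (hu : ∀ S, Tendsto (fun e => π e * S) l (𝓝 S)) (x : W.X) :
    ∃ ξ, ∀ S, Z.ract ξ S = m x S := by
  have hc : Cauchy (l.map fun e => m x (π e)) := by
    have h1 := (W.tendsto_ract hb hr x).cauchy_map
    rw [cauchy_map_iff'] at h1 ⊢
    rw [tendsto_uniformity_iff_dist_tendsto_zero] at h1 ⊢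
    refine squeeze_zero (fun _ => dist_nonneg) (fun p => ?_) h1
    rw [dist_eq_norm, dist_eq_norm]
    have e1 : m x (π p.1) - m x (π p.2) = m x (π (p.1 - p.2)) := by
      rw [hπ.map_sub]; exact ((h.tmulLeft hπ x).map_sub _ _).symm
    have e2 : W.ract x p.1 - W.ract x p.2 = W.ract x (p.1 - p.2) := (W.ract_sub_right _ _ _).symm
    rw [e1, e2]
    exact h.norm_pi_le hπ x _
  obtain ⟨ξ, hξ⟩ := CompleteSpace.complete hc
  refine ⟨ξ, fun S => tendsto_nhds_unique
    (((Z.continuous_ract S).tendsto ξ).comp hξ) ?_⟩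
  refine (((h.tmulLeft hπ x).continuous.tendsto S).comp (hu S)).congr fun e => ?_
  exact (h.ract x (π e) S).symm

/-- The inner product of `x ⊗ 1` and `y ⊗ 1`. -/
lemma inner_tmul_one (h : MixedMod W B π Z m) {x y : W.X} {ξ η : Z.X}
    (hξ : ∀ S, Z.ract ξ S = m x S) (hη : ∀ S, Z.ract η S = m y S) :
    Z.inner ξ η = π (W.inner x y) := by
  have h1 : ∀ S T, star S * ((Z.inner ξ η - π (W.inner x y)) * T) = 0 := fun S T => by
    have := h.inner x S y T
    rw [← hξ, ← hη, Z.inner_ract_left, Z.inner_ract_right] at this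
    rw [sub_mul, mul_sub, ← this, sub_self]
  set D := Z.inner ξ η - π (W.inner x y)
  have h2 : star (star D * D) * (star D * D) = 0 := by
    rw [star_mul, star_star, mul_assoc, h1]
  rw [CStarRing.star_mul_self_eq_zero_iff, CStarRing.star_mul_self_eq_zero_iff] at h2
  exact sub_eq_zero.mp h2

end MixedMod

/-- A bare continuous linear map as a bundled one. -/
def IsCLMap.toCLM {E F : Type u} [NormedAddCommGroup E] [NormedSpace ℂ E]
    [NormedAddCommGroup F] [NormedSpace ℂ F] {f : E → F} (h : IsCLMap f) : E →L[ℂ] F where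
  toFun := f
  map_add' := h.map_add
  map_smul' := h.map_smul
  cont := h.cont

lemma CorrIso.isCLMap {W V : Corr A} (e : CorrIso W V) : IsCLMap e.toFun := by
  let f : W.X →ₗ[ℂ] V.X := { toFun := e.toFun, map_add' := e.map_add, map_smul' := e.map_smul }
  have hf : ∀ x, ‖f x‖ ≤ 1 * ‖x‖ := fun x => by
    rw [one_mul]
    refine abs_le_of_sq_le_sq' ?_ (norm_nonneg _) |>.2
    rw [V.norm_eq, W.norm_eq]
    exact (congrArg norm (e.map_inner x x)).le
  exact ⟨e.map_add, e.map_smul, (f.mkContinuous 1 hf).continuous⟩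

lemma IsRep.isCLMap {W : Corr A} {π : A → B} {t : W.X → B} (h : IsRep W π t) : IsCLMap t :=
  ⟨h.t_add, h.t_smul, h.continuous⟩

lemma IsCLMap.comp {E F K : Type u} [NormedAddCommGroup E] [NormedSpace ℂ E]
    [NormedAddCommGroup F] [NormedSpace ℂ F] [NormedAddCommGroup K] [NormedSpace ℂ K]
    {g : F → K} {f : E → F} (hg : IsCLMap g) (hf : IsCLMap f) : IsCLMap fun x => g (f x) :=
  { map_add := (hg.toCLM.comp hf.toCLM).map_add
    map_smul := (hg.toCLM.comp hf.toCLM).map_smul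
    cont := hg.cont.comp hf.cont }

lemma IsStarHom.comp {C : Type u} [NonUnitalCStarAlgebra C] {ρ : B → C} {π : A → B}
    (hρ : IsStarHom ρ) (hπ : IsStarHom π) : IsStarHom fun a => ρ (π a) where
  map_add a b := by rw [hπ.map_add, hρ.map_add]
  map_mul a b := by rw [hπ.map_mul, hρ.map_mul]
  map_star a := by rw [hπ.map_star, hρ.map_star]
  map_smul c a := by rw [hπ.map_smul, hρ.map_smul]

lemma IsRep.hom_comp {C : Type u} [NonUnitalCStarAlgebra C] {ρ : B → C} {W : Corr A}
    {π : A → B} {t : W.X → B} (hρ : IsStarHom ρ) (h : IsRep W π t) :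
    IsRep W (fun a => ρ (π a)) (fun x => ρ (t x)) where
  hom := hρ.comp h.hom
  t_add x y := by rw [h.t_add, hρ.map_add]
  t_smul c x := by rw [h.t_smul, hρ.map_smul]
  lact a x := by rw [h.lact, hρ.map_mul]
  ract x a := by rw [h.ract, hρ.map_mul]
  inner x y := by rw [← hρ.map_star, ← hρ.map_mul, h.inner]

lemma CPCov.hom_comp {C : Type u} [NonUnitalCStarAlgebra C] {ρ : B → C} {W : Corr A}
    {π : A → B} {t : W.X → B} (hρ : IsStarHom ρ) (h : CPCov W π t) :
    CPCov W (fun a => ρ (π a)) (fun x => ρ (t x)) := by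
  intro a N x y hlim
  refine ((hρ.continuous.tendsto _).comp (h a N x y hlim)).congr fun n => ?_
  simp only [Function.comp_apply, hρ.map_sum, hρ.map_mul, hρ.map_star]

namespace MixedMod

variable {W : Corr A} {π : A → B} {Z : Corr B} {m : W.X → B → Z.X}
  {C : Type u} [NonUnitalCStarAlgebra C] {ρ : B → C} {t : Z.X → C} {σ : W.X → C}

/-- A representation of `W ⊗ B` restricts to a representation of `W` along `x ↦ x ⊗ 1`. -/
lemma isRep_tmul_one (h : MixedMod W B π Z m) (hπ : IsStarHom π) (ht : IsRep Z ρ t)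
    (hlact : ∀ a x S, Z.lactL (π a) (m x S) = m (W.lactL a x) S)
    (hone : ∀ x, ∃ ξ, ∀ S, Z.ract ξ S = m x S)
    (hσ : ∀ x ξ, (∀ S, Z.ract ξ S = m x S) → σ x = t ξ) :
    IsRep W (fun a => ρ (π a)) σ := by
  choose ξ hξ using hone
  have hσξ : ∀ x, σ x = t (ξ x) := fun x => hσ x _ (hξ x)
  refine ⟨ht.hom.comp hπ, fun x y => ?_, fun c x => ?_, fun a x => ?_, fun x a => ?_,
    fun x y => ?_⟩
  · rw [hσξ x, hσξ y, ← ht.t_add]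
    exact hσ _ _ fun S => by rw [Z.ract_add_left, hξ, hξ, h.add_left]
  · rw [hσξ x, ← ht.t_smul]
    exact hσ _ _ fun S => by rw [Z.ract_smul, hξ, h.smul_left]
  · rw [hσξ x, ← ht.lact]
    exact hσ _ _ fun S => by rw [← Z.lact_ract, hξ, hlact]
  · rw [hσξ x, ← ht.ract]
    exact hσ _ _ fun S => by rw [← Z.ract_mul, hξ, h.balanced]
  · rw [hσξ x, hσξ y, ht.inner, h.inner_tmul_one (hξ x) (hξ y)]

/-- Covariance of a representation of `W ⊗ B` passes to the representation of `W` obtained along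
`x ↦ x ⊗ 1`. -/
lemma cpDense_tmul_one (h : MixedMod W B π Z m) (hπ : IsStarHom π) (ht : IsRep Z ρ t)
    (hlact : ∀ a x S, Z.lactL (π a) (m x S) = m (W.lactL a x) S)
    (hone : ∀ x, ∃ ξ, ∀ S, Z.ract ξ S = m x S)
    (hσ : ∀ x ξ, (∀ S, Z.ract ξ S = m x S) → σ x = t ξ)
    (hW : W.Regular) (hi : Function.Injective ρ) (hc : CPCov Z ρ t) :
    CPDense W (fun a => ρ (π a)) σ := by
  have hrep := h.isRep_tmul_one hπ ht hlact hone hσ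
  choose ξ hξ using hone
  have hσξ : σ = fun x => t (ξ x) := funext fun x => hσ x _ (hξ x)
  intro a
  obtain ⟨u, hu, hlim⟩ := mem_closure_iff_seq_limit.mp (hW.2 a)
  choose N x y hxy using fun n => exists_sum_of_mem_span W.rankOne_smul_left (hu n)
  let R : ℕ → Z.X →L[ℂ] Z.X := fun n => ∑ r, Z.rankOne (ξ (x n r)) (ξ (y n r))
  have hR : ∀ n z S, R n (m z S) = m (u n z) S := by
    intro n z S
    have h1 : m (u n z) S = ∑ r, m (W.rankOne (x n r) (y n r) z) S := by
      rw [hxy, _root_.sum_apply]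
      exact map_sum (h.tmulRight hπ S) _ _
    rw [h1, _root_.sum_apply]
    refine Finset.sum_congr rfl fun r _ => ?_
    obtain ⟨ζ, hζ⟩ : ∃ ζ, ∀ S, Z.ract ζ S = m z S := ⟨ξ z, hξ z⟩
    rw [Z.rankOne_apply, ← hζ, Z.inner_ract_right, h.inner_tmul_one (hξ _) hζ, Z.ract_mul,
      W.rankOne_apply, h.balanced, ← hξ, Z.ract_mul]
  have hcau : CauchySeq R := by
    have h1 := hlim.cauchySeq
    rw [cauchySeq_iff_tendsto_dist_atTop_0] at h1 ⊢
    refine squeeze_zero (fun _ => dist_nonneg) (fun p => ?_)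
      (by simpa only [mul_zero] using h1.const_mul 3)
    rw [dist_eq_norm, dist_eq_norm]
    refine ContinuousLinearMap.opNorm_le_bound _ (by positivity) fun z => ?_
    rw [← ht.norm_eq hi, ← ht.norm_eq hi z, sub_apply, ht.map_sub, ← ht.rankOne_sum_mul,
      ← ht.rankOne_sum_mul, ← sub_mul, hxy, hxy]
    refine (norm_mul_le _ _).trans ?_
    gcongr
    have h2 := hrep.norm_sum_sub_sum_le (x p.1) (y p.1) (x p.2) (y p.2)
    simpa only [hσξ] using h2
  obtain ⟨L, hL⟩ := cauchySeq_tendsto_of_complete hcau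
  have hLa : L = Z.lactL (π a) := by
    refine h.clm_ext fun z S => ?_
    rw [hlact]
    refine tendsto_nhds_unique
      (((ContinuousLinearMap.apply ℂ Z.X (m z S)).continuous.tendsto L).comp hL) ?_
    refine ((((h.tmulRight hπ S).continuous.comp
      (ContinuousLinearMap.apply ℂ W.X z).continuous).tendsto (W.lactL a)).comp hlim).congr
      fun n => ?_
    exact (hR n z S).symm
  refine mem_closure_of_tendsto (hc (π a) N (fun n r => ξ (x n r)) (fun n r => ξ (y n r))
    (hLa ▸ hL)) (Eventually.of_forall fun n => ?_)
  have h3 := sum_mem_ketBra σ Finset.univ (x n) (y n)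
  simpa only [hσξ, SetLike.mem_coe] using h3

end MixedMod

/-- The commutation relation between the two representations attached to a covariant
representation of `Yᵢ ⊗ 𝒪(Y₁)`. -/
lemma ECorrData.map_flip {Y₁ Yi T T' : Corr A} {mT : Y₁.X → Yi.X → T.X}
    {mT' : Yi.X → Y₁.X → T'.X} {θ : T.X → T'.X} {C : CPAlg Y₁} {Z : Corr C.O}
    {m : Yi.X → C.O → Z.X} (h : ECorrData Y₁ Yi T mT T' mT' θ C Z m)
    (hT : IsTensor Y₁ Yi T mT) (hθ : IsCLMap θ) {ρ : C.O → B} {t : Z.X → B}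
    (ht : IsRep Z ρ t) {σ : Yi.X → B} (hσ : IsRep Yi (fun a => ρ (C.π a)) σ)
    (hσm : ∀ y S, σ y * ρ S = t (m y S)) {τ : T.X → B} (hτ : IsCLMap τ)
    (hτm : ∀ x y, τ (mT x y) = ρ (C.t x) * σ y) {w : T.X} {y : Yi.X} {x : Y₁.X}
    (hw : θ w = mT' y x) : τ w = σ y * ρ (C.t x) := by
  obtain ⟨μ, hμ, hμm, hμθ⟩ := h.lact_t
  have hrep := C.isRep.hom_comp ht.hom
  have key : ∀ S, τ w * ρ S = σ y * ρ (C.t x) * ρ S := by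
    intro S
    have h1 : τ w * ρ S = t (μ (θ w) S) := by
      refine DFunLike.congr_fun (hT.clm_ext
        (f := ((ContinuousLinearMap.mul ℂ B).flip (ρ S)).comp hτ.toCLM)
        (g := (ht.isCLMap.comp ((hμ S).comp hθ)).toCLM) fun x y => ?_) w
      change τ (mT x y) * ρ S = t (μ (θ (mT x y)) S)
      rw [hτm, ← hμθ, ht.lact, ← hσm, mul_assoc]
    rw [h1, hw, hμm, ← hσm, ht.hom.map_mul, mul_assoc]
  obtain ⟨v, hv, hvm⟩ := hT.exists_isRep hrep hσ
  obtain rfl : τ = v := funext fun z => DFunLike.congr_fun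
    (hT.clm_ext (f := hτ.toCLM) (g := hv.toCLM) fun x y => (hτm x y).trans (hvm x y).symm) z
  obtain ⟨l, hl, hb, -, hr⟩ := exists_approximateUnit A
  refine tendsto_nhds_unique (((hv.continuous.tendsto w).comp (T.tendsto_ract hb hr w)).congr
    fun e => ?_) (((hrep.continuous.tendsto x).comp (Y₁.tendsto_ract hb hr x)).const_mul (σ y))
  simp only [Function.comp_apply]
  rw [hv.ract, hrep.ract, key, mul_assoc]

/-- Let `X` be a product system over `ℕ²` with
generating system `(Y, θ)`, `ℰY₂ = Y₂ ⊗_A 𝒪(Y₁)` (left action via `θ₁₂`),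
with universal covariant representation `(π_{ℰY₂}, t_{ℰY₂})` of `ℰY₂` in
`𝒪(ℰY₂)`.  Define `σ₀(a) = π_{ℰY₂}(π_{Y₁}(a))`,
`σ₁(y) = π_{ℰY₂}(t_{Y₁}(y))`, and `σ₂(x) = t_{ℰY₂}(x ⊗ 1)`.  Then
`(σ₀,σ₁)` and `(σ₀,σ₂)` are Cuntz–Pimsner covariant representations of
`Y₁` and `Y₂` in `𝒪(ℰY₂)` satisfying `σ₂σ₁ = σ₁σ₂ ∘ θ₂₁`; consequently
there is an essentially unique Cuntz–Pimsner covariant representation `ψ`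
of `X` in `𝒪(ℰY₂)` with `ψ_{e_i} = σ_i` and `ψ₀ = σ₀`. -/
theorem sigma_reps_and_induced_covariant_rep
    {A : Type u} [NonUnitalCStarAlgebra A]
    (G : GenSys A 2) (Xs : PSys A 2) (gen : Generates G Xs)
    (C1 : CPAlg (G.Y 0))
    (Z : Corr C1.O) (mm : (G.Y 1).X → C1.O → Z.X)
    (hZ : ECorr G 0 1 C1 Z mm)
    (C2 : CPAlg Z)
    -- `σ₂(x) = t_{ℰY₂}(x ⊗ 1)`, where `x ⊗ 1 ∈ ℰY₂` is the element
    -- representing the multiplier `S ↦ x ⊗ S`: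
    (σ2 : (G.Y 1).X → C2.O)
    (hσ2 : ∀ x ξ, (∀ S, Z.ract ξ S = mm x S) → σ2 x = C2.t ξ) :
    IsRep (G.Y 0) (fun a => C2.π (C1.π a)) (fun y => C2.π (C1.t y)) ∧
    CPCov (G.Y 0) (fun a => C2.π (C1.π a)) (fun y => C2.π (C1.t y)) ∧
    IsRep (G.Y 1) (fun a => C2.π (C1.π a)) σ2 ∧
    CPCov (G.Y 1) (fun a => C2.π (C1.π a)) σ2 ∧
    -- `σ₂ σ₁ = σ₁ σ₂ ∘ θ₂₁`:
    (∀ (τ : (G.T 0 1).X → C2.O), IsCLMap τ →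
      (∀ x y, τ (G.tmul 0 1 x y) = C2.π (C1.t x) * σ2 y) →
      ∀ y x, τ ((G.θ 1 0).toFun (G.tmul 1 0 y x)) = σ2 y * C2.π (C1.t x)) ∧
    ∃ ψ : PSRep Xs C2.O, PSCPCov ψ ∧
      ψ.π = (fun a => C2.π (C1.π a)) ∧
      (∀ x, ψ.ψ (egen 0) ((gen.ι 0).toFun x) = C2.π (C1.t x)) ∧
      (∀ y, ψ.ψ (egen 1) ((gen.ι 1).toFun y) = σ2 y) ∧
      ∀ ψ' : PSRep Xs C2.O,
        ψ'.π = (fun a => C2.π (C1.π a)) →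
        (∀ x, ψ'.ψ (egen 0) ((gen.ι 0).toFun x) = C2.π (C1.t x)) →
        (∀ y, ψ'.ψ (egen 1) ((gen.ι 1).toFun y) = σ2 y) →
        ∀ s x, ψ'.ψ s x = ψ.ψ s x := by
  have h1 := C1.isRep.hom_comp C2.isRep.hom
  have c1 := C1.covariant.hom_comp C2.isRep.hom
  have hi : Function.Injective fun a => C2.π (C1.π a) := C2.inj.comp C1.inj
  have hone : ∀ x, ∃ ξ, ∀ S, Z.ract ξ S = mm x S := by
    obtain ⟨l, hl, hb, hl', hr⟩ := exists_approximateUnit A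
    exact hZ.mod.exists_tmul_one C1.isRep.hom hb hr (C1.tendsto_pi_mul (G.reg 0).1 hb hl')
  have h2 : IsRep (G.Y 1) (fun a => C2.π (C1.π a)) σ2 :=
    hZ.mod.isRep_tmul_one C1.isRep.hom C2.isRep hZ.lact_pi hone hσ2
  have d1 := c1.cpDense (G.reg 0).2
  have d2 : CPDense (G.Y 1) (fun a => C2.π (C1.π a)) σ2 :=
    hZ.mod.cpDense_tmul_one C1.isRep.hom C2.isRep hZ.lact_pi hone hσ2 (G.reg 1).2 C2.inj
      C2.covariant
  have hσm : ∀ y S, σ2 y * C2.π S = C2.t (mm y S) := fun y S => by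
    obtain ⟨ξ, hξ⟩ := hone y
    rw [hσ2 y ξ hξ, ← hξ, C2.isRep.ract]
  have hflip : ∀ (τ : (G.T 0 1).X → C2.O), IsCLMap τ →
      (∀ x y, τ (G.tmul 0 1 x y) = C2.π (C1.t x) * σ2 y) →
      ∀ y x, τ ((G.θ 1 0).toFun (G.tmul 1 0 y x)) = σ2 y * C2.π (C1.t x) :=
    fun τ hτ hτm y x => hZ.map_flip (G.isTensor 0 1) (G.θ 0 1).isCLMap C2.isRep h2 hσm hτ hτm
      (G.θ_symm 1 0 _)
  refine ⟨h1, c1, h2, d2.cpCov h2 hi, hflip, ?_⟩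
  let ρ : ∀ i : Fin 2, (G.Y i).X → C2.O := fun i => match i with
    | 0 => fun x => C2.π (C1.t x)
    | 1 => σ2
  have hρ : ∀ i, IsRep (G.Y i) (fun a => C2.π (C1.π a)) (ρ i) := Fin.forall_fin_two.mpr ⟨h1, h2⟩
  have dρ : ∀ i, CPDense (G.Y i) (fun a => C2.π (C1.π a)) (ρ i) :=
    Fin.forall_fin_two.mpr ⟨d1, d2⟩
  obtain ⟨r, hrπ, hr⟩ := PSys.exists_psRep (Xs := Xs) hi h1.hom
    (fun i x => ρ i ((gen.ι i).invFun x)) (fun i => (hρ i).congr_iso (gen.ι i)) (by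
      intro v hv hvm y x z hz
      have h := hflip (fun w => v ((gen.κ 0 1).toFun w)) (hv.isCLMap.comp (gen.κ 0 1).isCLMap)
        (fun x y => by
          rw [gen.κ_mul, hvm, (gen.ι 0).left_inv, (gen.ι 1).left_inv])
        ((gen.ι 1).invFun y) ((gen.ι 0).invFun x)
      refine (congrArg v (eq_of_heq ?_)).trans h
      refine hz.trans ((gen.θ_compat 1 0 _).trans (heq_of_eq ?_)).symm
      rw [gen.κ_mul, (gen.ι 1).right_inv, (gen.ι 0).right_inv])
  have hrι : ∀ i x, r.ψ (egen i) ((gen.ι i).toFun x) = ρ i x := fun i x => by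
    rw [hr]
    exact congrArg (ρ i) ((gen.ι i).left_inv x)
  refine ⟨r, fun s => ?_, hrπ, hrι 0, hrι 1, fun r' hπ' h0' h1' => ?_⟩
  · refine (r.cpDense (fun i => ?_) s).cpCov (r.isRep s) (hrπ ▸ hi)
    rw [hr, hrπ]
    exact (dρ i).congr_iso (gen.ι i)
  · refine PSRep.ext_egen (hπ'.trans hrπ.symm) fun i x => ?_
    obtain ⟨x, rfl⟩ : ∃ x', x = (gen.ι i).toFun x' := ⟨_, ((gen.ι i).right_inv x).symm⟩
    rw [hrι]
    revert i
    exact Fin.forall_fin_two.mpr ⟨h0', h1'⟩
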